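/- arXiv:1909.09043 — 2 statements merged into one kernel-verified Lean document; each statement's English description precedes it below -/
import Mathlib

section
/- There exists a simple 12-gon with region P ⊆ ℝ² and vertex cycle v 0, …, v 11 such that (1) for every starting index k, some point outside P is not observed by the every-second-vertex guard set G_k = {v((k + 2j) mod 12) : 0 ≤ j < 6}, and yet (2) there exist 4 points g₁, g₂, g₃, g₄ in ℝ² such that every point X outside P is visible from at least one of g₁, g₂, g₃, g₄. -/
/-- A simple `n`-gon in the plane: `n ≥ 3` distinct vertices `v 0, …, v (n-1)`
(indices mod `n`, so indexed by `ZMod n`), whose consecutive edges meet exactly in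
their shared endpoint and whose non-consecutive edges are disjoint, together with a
compact region `P` equal to the closure of its interior whose topological frontier
is the union of the edges. -/
def IsSimplePolygon (n : ℕ) (v : ZMod n → ℝ × ℝ) (P : Set (ℝ × ℝ)) : Prop :=
  3 ≤ n ∧
  Function.Injective v ∧
  (∀ i : ZMod n,
    segment ℝ (v i) (v (i + 1)) ∩ segment ℝ (v (i + 1)) (v (i + 2)) = {v (i + 1)}) ∧
  (∀ i j : ZMod n, j ≠ i → j ≠ i + 1 → i ≠ j + 1 →
    segment ℝ (v i) (v (i + 1)) ∩ segment ℝ (v j) (v (j + 1)) = ∅) ∧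
  IsCompact P ∧
  P = closure (interior P) ∧
  frontier P = ⋃ i : ZMod n, segment ℝ (v i) (v (i + 1))

/-- The every-second-vertex guard set with starting index `k`:
`G_k = {v ((k + 2*j) mod n) : 0 ≤ j < ⌈n/2⌉}`. -/
def EverySecondGuards (n : ℕ) (v : ZMod n → ℝ × ℝ) (k : ZMod n) : Set (ℝ × ℝ) :=
  {p | ∃ j : ℕ, j < (n + 1) / 2 ∧ p = v (k + ((2 * j : ℕ) : ZMod n))}

/-- The affine form `p ↦ a * p.1 + b * p.2 + c` with integer coefficients `(a, b, c)`. -/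
def affineForm (h : ℤ × ℤ × ℤ) (p : ℝ × ℝ) : ℝ := h.1 * p.1 + h.2.1 * p.2 + h.2.2

/-- The intersection of the closed half-planes on which the given forms are nonnegative. -/
def closedCell (L : List (ℤ × ℤ × ℤ)) : Set (ℝ × ℝ) := {p | ∀ h ∈ L, 0 ≤ affineForm h p}

/-- The intersection of the open half-planes on which the given forms are positive. -/
def openCell (L : List (ℤ × ℤ × ℤ)) : Set (ℝ × ℝ) := {p | ∀ h ∈ L, 0 < affineForm h p}

theorem continuous_affineForm (h : ℤ × ℤ × ℤ) : Continuous (affineForm h) := by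
  unfold affineForm; fun_prop

theorem affineForm_combo (h : ℤ × ℤ × ℤ) (p q : ℝ × ℝ) {s t : ℝ} (hst : s + t = 1) :
    affineForm h (s • p + t • q) = s * affineForm h p + t * affineForm h q := by
  obtain rfl : s = 1 - t := by linarith
  simp [affineForm]; ring

theorem isOpen_openCell (L : List (ℤ × ℤ × ℤ)) : IsOpen (openCell L) := by
  have : openCell L = ⋂ h ∈ L.toFinset, {p | 0 < affineForm h p} := by
    ext; simp [openCell]
  rw [this]
  exact isOpen_biInter_finset fun h _ => isOpen_lt continuous_const (continuous_affineForm h)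

theorem isClosed_closedCell (L : List (ℤ × ℤ × ℤ)) : IsClosed (closedCell L) := by
  have : closedCell L = ⋂ h ∈ L, {p | 0 ≤ affineForm h p} := by
    ext; simp [closedCell]
  rw [this]
  exact isClosed_biInter fun h _ => isClosed_le continuous_const (continuous_affineForm h)

theorem convex_closedCell (L : List (ℤ × ℤ × ℤ)) : Convex ℝ (closedCell L) := by
  intro p hp q hq s t hs ht hst h hh
  rw [affineForm_combo h p q hst]
  exact add_nonneg (mul_nonneg hs (hp h hh)) (mul_nonneg ht (hq h hh))

theorem openCell_subset_closedCell (L : List (ℤ × ℤ × ℤ)) : openCell L ⊆ closedCell L :=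
  fun _ hp h hh => (hp h hh).le

theorem closedCell_subset_closure_openCell {L : List (ℤ × ℤ × ℤ)} (hL : (openCell L).Nonempty) :
    closedCell L ⊆ closure (openCell L) := by
  obtain ⟨q, hq⟩ := hL
  intro p hp
  refine closure_mono (s := openSegment ℝ p q) ?_ ?_
  · rintro _ ⟨s, t, hs, ht, hst, rfl⟩ h hh
    rw [affineForm_combo h p q hst]
    exact add_pos_of_nonneg_of_pos (mul_nonneg hs.le (hp h hh)) (mul_pos ht (hq h hh))
  · exact segment_subset_closure_openSegment (left_mem_segment ℝ p q)

/-- The region covered by finitely many closed cells. -/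
def cellUnion {ι : Type*} (L : ι → List (ℤ × ℤ × ℤ)) : Set (ℝ × ℝ) := ⋃ i, closedCell (L i)

theorem disjoint_closedCell_interior {L : List (ℤ × ℤ × ℤ)} {P : Set (ℝ × ℝ)}
    (hL : (openCell L).Nonempty) (hP : Disjoint (openCell L) P) :
    Disjoint (closedCell L) (interior P) :=
  ((hP.mono_right interior_subset).closure_left isOpen_interior).mono_left
    (closedCell_subset_closure_openCell hL)

section Region

variable {ι κ : Type*} {L : ι → List (ℤ × ℤ × ℤ)} {M : κ → List (ℤ × ℤ × ℤ)} {E : Set (ℝ × ℝ)}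

theorem isClosed_cellUnion [Finite ι] : IsClosed (cellUnion L) :=
  isClosed_iUnion_of_finite fun i => isClosed_closedCell (L i)

theorem openCell_subset_interior_cellUnion (i : ι) : openCell (L i) ⊆ interior (cellUnion L) :=
  interior_maximal ((openCell_subset_closedCell _).trans
    (Set.subset_iUnion (fun i => closedCell (L i)) i)) (isOpen_openCell _)

theorem cellUnion_eq_closure_interior [Finite ι] (hL : ∀ i, (openCell (L i)).Nonempty) :
    cellUnion L = closure (interior (cellUnion L)) := by
  refine subset_antisymm (Set.iUnion_subset fun i => ?_)
    (closure_minimal interior_subset isClosed_cellUnion)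
  exact (closedCell_subset_closure_openCell (hL i)).trans
    (closure_mono (openCell_subset_interior_cellUnion i))

theorem frontier_cellUnion [Finite ι] (hM : ∀ j, (openCell (M j)).Nonempty)
    (hLM : ∀ j, Disjoint (openCell (M j)) (cellUnion L))
    (hEL : E ⊆ cellUnion L) (hEM : E ⊆ cellUnion M)
    (hLE : ∀ i, closedCell (L i) ⊆ E ∪ ⋃ k, openCell (L k)) :
    frontier (cellUnion L) = E := by
  rw [isClosed_cellUnion.frontier_eq]
  refine subset_antisymm ?_ fun p hp => ⟨hEL hp, ?_⟩
  · rintro p ⟨hp, hpi⟩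
    obtain ⟨i, hi⟩ := Set.mem_iUnion.1 hp
    refine (hLE i hi).resolve_right fun h => hpi ?_
    obtain ⟨k, hk⟩ := Set.mem_iUnion.1 h
    exact openCell_subset_interior_cellUnion k hk
  · obtain ⟨j, hj⟩ := Set.mem_iUnion.1 (hEM hp)
    exact (disjoint_closedCell_interior (hM j) (hLM j)).notMem_of_mem_left hj

end Region

/-- Twice the signed area of the triangle `a b c`. -/
def cross {R : Type*} [Ring R] (a b c : R × R) : R :=
  (b.1 - a.1) * (c.2 - a.2) - (b.2 - a.2) * (c.1 - a.1)

theorem cross_combo (a b c d : ℝ × ℝ) {s t : ℝ} (hst : s + t = 1) :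
    cross a b (s • c + t • d) = s * cross a b c + t * cross a b d := by
  obtain rfl : s = 1 - t := by linarith
  simp [cross]; ring

theorem cross_eq_zero_of_mem_segment {a b p : ℝ × ℝ} (hp : p ∈ segment ℝ a b) :
    cross a b p = 0 := by
  obtain ⟨s, t, -, -, hst, rfl⟩ := hp
  rw [cross_combo a b a b hst]
  simp only [cross]; ring

theorem segment_inter_segment_eq_empty {a b c d : ℝ × ℝ}
    (h : 0 < cross a b c * cross a b d) : segment ℝ a b ∩ segment ℝ c d = ∅ := by
  refine Set.eq_empty_of_forall_notMem ?_
  rintro p ⟨hab, s, t, hs, ht, hst, rfl⟩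
  have h0 := cross_eq_zero_of_mem_segment hab
  rw [cross_combo a b c d hst] at h0
  rcases mul_pos_iff.1 h with ⟨hc, hd⟩ | ⟨hc, hd⟩ <;>
    rcases hs.eq_or_lt with rfl | hs <;> nlinarith

theorem segment_inter_segment_eq_singleton {a b c : ℝ × ℝ} (h : cross a b c ≠ 0) :
    segment ℝ a b ∩ segment ℝ b c = {b} := by
  refine subset_antisymm ?_ (Set.singleton_subset_iff.2
    ⟨right_mem_segment ℝ a b, left_mem_segment ℝ b c⟩)
  rintro p ⟨hab, s, t, hs, ht, hst, rfl⟩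
  have h0 := cross_eq_zero_of_mem_segment hab
  rw [cross_combo a b b c hst, cross_eq_zero_of_mem_segment (right_mem_segment ℝ a b), mul_zero,
    zero_add] at h0
  obtain rfl : t = 0 := (mul_eq_zero.1 h0).resolve_right h
  obtain rfl : s = 1 := by linarith
  simp

theorem mem_segment_of_cross_eq_zero {a b p : ℝ × ℝ} (h : cross a b p = 0)
    (h₀ : 0 ≤ (p.1 - a.1) * (b.1 - a.1) + (p.2 - a.2) * (b.2 - a.2))
    (h₁ : 0 ≤ (b.1 - p.1) * (b.1 - a.1) + (b.2 - p.2) * (b.2 - a.2)) (hab : a ≠ b) :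
    p ∈ segment ℝ a b := by
  have hN : 0 < (b.1 - a.1) ^ 2 + (b.2 - a.2) ^ 2 := by
    by_contra hN
    refine hab (Prod.ext ?_ ?_) <;> nlinarith [sq_nonneg (b.1 - a.1), sq_nonneg (b.2 - a.2)]
  refine ⟨((b.1 - p.1) * (b.1 - a.1) + (b.2 - p.2) * (b.2 - a.2)) /
      ((b.1 - a.1) ^ 2 + (b.2 - a.2) ^ 2),
    ((p.1 - a.1) * (b.1 - a.1) + (p.2 - a.2) * (b.2 - a.2)) /
      ((b.1 - a.1) ^ 2 + (b.2 - a.2) ^ 2), by positivity, by positivity, ?_, ?_⟩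
  · field_simp; ring
  · simp only [cross] at h
    ext
    · simp only [Prod.fst_add, Prod.smul_fst, smul_eq_mul]
      field_simp
      linear_combination (b.2 - a.2) * h
    · simp only [Prod.snd_add, Prod.smul_snd, smul_eq_mul]
      field_simp
      linear_combination (a.1 - b.1) * h

/-- The real point with the given integer coordinates. -/
def toPlane (a : ℤ × ℤ) : ℝ × ℝ := (a.1, a.2)

theorem toPlane_injective : Function.Injective toPlane := fun a b h => by
  simpa [toPlane, Prod.ext_iff] using h

theorem cross_toPlane (a b c : ℤ × ℤ) :
    cross (toPlane a) (toPlane b) (toPlane c) = (cross a b c : ℤ) := by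
  simp [cross, toPlane]

theorem toPlane_mem_closedCell {L : List (ℤ × ℤ × ℤ)} {a : ℤ × ℤ}
    (h : ∀ f ∈ L, 0 ≤ f.1 * a.1 + f.2.1 * a.2 + f.2.2) : toPlane a ∈ closedCell L := by
  intro f hf
  simp only [affineForm, toPlane]
  exact_mod_cast h f hf

theorem toPlane_mem_openCell {L : List (ℤ × ℤ × ℤ)} {a : ℤ × ℤ}
    (h : ∀ f ∈ L, 0 < f.1 * a.1 + f.2.1 * a.2 + f.2.2) : toPlane a ∈ openCell L := by
  intro f hf
  simp only [affineForm, toPlane]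
  exact_mod_cast h f hf

theorem segment_inter_openCell_nonempty {L : List (ℤ × ℤ × ℤ)} {a b : ℤ × ℤ} {s t : ℤ}
    (hs : 0 < s) (ht : 0 < t)
    (h : ∀ f ∈ L, 0 < s * (f.1 * a.1 + f.2.1 * a.2 + f.2.2) +
      t * (f.1 * b.1 + f.2.1 * b.2 + f.2.2)) :
    (segment ℝ (toPlane a) (toPlane b) ∩ openCell L).Nonempty := by
  have hs' : (0 : ℝ) < s := by exact_mod_cast hs
  have ht' : (0 : ℝ) < t := by exact_mod_cast ht
  have hst : (s : ℝ) / (s + t) + t / (s + t) = 1 := by field_simp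
  refine ⟨_, ⟨s / (s + t), t / (s + t), by positivity, by positivity, hst, rfl⟩, fun f hf => ?_⟩
  rw [affineForm_combo f _ _ hst, div_mul_eq_mul_div, div_mul_eq_mul_div, ← add_div]
  refine div_pos ?_ (by positivity)
  simp only [affineForm, toPlane]
  exact_mod_cast h f hf

/-- The vertices of the 12-gon. -/
def vertexCoord : ZMod 12 → ℤ × ℤ :=
  (![(-2, -4), (9, 1), (16, -4), (15, -3), (17, 10), (15, 5), (4, 0), (-3, 5), (-2, 4), (-5, -12), (-5, 44), (40, -12)] : Fin 12 → ℤ × ℤ)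

/-- Convex cells whose closures cover the polygon and whose interiors cover its interior. -/
def interiorCells : Fin 7 → List (ℤ × ℤ × ℤ) :=
  ![[(1, 0, 5), (-16, 3, -44), (-1, -1, 2)],
    [(5, 7, -20), (-5, 11, 20), (-5, 2, 65), (-56, -45, 1700), (1, 0, 5)],
    [(13, -2, -201), (1, 1, -12), (-56, -45, 1700), (4, 21, 92)],
    [(5, -11, -34), (-5, -7, 52), (4, 21, 92)],
    [(-17, 2, -61), (1, 0, 5), (-39, -2, -107)],
    [(0, -1, -4), (-1, -3, 4), (4, 21, 92)],
    [(17, 11, -399), (-56, -45, 1700), (22, 23, -604)]]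

/-- Convex cells covering the complement of the polygon: the three half-planes outside its convex
hull and the nine triangles of a triangulation of its pocket. -/
def exteriorCells : Fin 12 → List (ℤ × ℤ × ℤ) :=
  ![[(-1, 0, -5)],
    [(56, 45, -1700)],
    [(0, -1, -12)],
    [(8, -3, 4), (0, 1, 12), (-4, -21, -92)],
    [(-1, 0, -2), (16, -3, 44), (-8, 3, -4)],
    [(-2, 3, 8), (-2, -3, 8), (1, 0, 2)],
    [(-5, -7, 20), (1, 1, -2), (2, 3, -8)],
    [(-5, 11, 34), (1, -5, -4), (2, -3, -8)],
    [(-2, 3, 15), (5, -11, -20), (-1, 5, 4)],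
    [(2, 3, -21), (-1, 0, 15), (2, -3, -15)],
    [(5, 7, -52), (-1, -1, 12), (-2, -3, 21)],
    [(-13, 2, 201), (5, -2, -65), (1, 0, -15)]]

/-- The union of the edges of the 12-gon. -/
def boundary : Set (ℝ × ℝ) :=
  ⋃ i : ZMod 12, segment ℝ (toPlane (vertexCoord i)) (toPlane (vertexCoord (i + 1)))

theorem mem_boundary {x y : ℝ} (i : ZMod 12) (a b : ℤ × ℤ) (ha : vertexCoord i = a)
    (hb : vertexCoord (i + 1) = b)
    (h : ((b.1 - a.1 : ℤ) : ℝ) * (y - a.2) - ((b.2 - a.2 : ℤ) : ℝ) * (x - a.1) = 0)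
    (h₀ : 0 ≤ (x - a.1) * ((b.1 - a.1 : ℤ) : ℝ) + (y - a.2) * ((b.2 - a.2 : ℤ) : ℝ))
    (h₁ : 0 ≤ (b.1 - x) * ((b.1 - a.1 : ℤ) : ℝ) + (b.2 - y) * ((b.2 - a.2 : ℤ) : ℝ)) :
    (x, y) ∈ boundary := by
  subst ha hb
  push_cast at h h₀ h₁
  refine Set.mem_iUnion.2 ⟨i, mem_segment_of_cross_eq_zero h h₀ h₁ ?_⟩
  exact toPlane_injective.ne ((by decide : ∀ i, vertexCoord i ≠ vertexCoord (i + 1)) i)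

theorem mem_interiorCells_or_mem_exteriorCells (x y : ℝ) :
    (∃ i, (x, y) ∈ closedCell (interiorCells i)) ∨
      ∃ j, (x, y) ∈ closedCell (exteriorCells j) := by
  rcases le_total (x + 5) 0 with h | h
  · exact Or.inr ⟨0, by simp [closedCell, affineForm, exteriorCells]; linarith⟩
  rcases le_total 0 (56 * x + 45 * y - 1700) with h | h
  · exact Or.inr ⟨1, by simp [closedCell, affineForm, exteriorCells]; linarith⟩
  rcases le_total (y + 12) 0 with h | h
  · exact Or.inr ⟨2, by simp [closedCell, affineForm, exteriorCells]; linarith⟩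
  rcases le_total 0 (x + 2) with h | h
  · rcases le_total 0 (4 * x + 21 * y + 92) with h | h
    · rcases le_total 0 (x - 15) with h | h
      · rcases le_total 0 (x + y - 12) with h | h
        · rcases le_total 0 (5 * x - 2 * y - 65) with h | h
          · rcases le_total 0 (13 * x - 2 * y - 201) with h | h
            · exact Or.inl ⟨2, by
                simp [closedCell, affineForm, interiorCells]
                constructorm* _ ∧ _ <;> linarith⟩
            · exact Or.inr ⟨11, by
                simp [closedCell, affineForm, exteriorCells]
                constructorm* _ ∧ _ <;> linarith⟩
          · exact Or.inl ⟨1, by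
              simp [closedCell, affineForm, interiorCells]
              constructorm* _ ∧ _ <;> linarith⟩
        · rcases le_total 0 (5 * x + 7 * y - 52) with h | h
          · exact Or.inr ⟨10, by
              simp [closedCell, affineForm, exteriorCells]
              constructorm* _ ∧ _ <;> linarith⟩
          · exact Or.inl ⟨3, by
              simp [closedCell, affineForm, interiorCells]
              constructorm* _ ∧ _ <;> linarith⟩
      · rcases le_total 0 (x - 5 * y - 4) with h | h
        · rcases le_total 0 (2 * x - 3 * y - 8) with h | h
          · rcases le_total 0 (2 * x + 3 * y - 21) with h | h
            · exact Or.inr ⟨9, by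
                simp [closedCell, affineForm, exteriorCells]
                constructorm* _ ∧ _ <;> linarith⟩
            · rcases le_total 0 (5 * x - 11 * y - 34) with h | h
              · rcases le_total 0 (5 * x + 7 * y - 52) with h | h
                · exact Or.inr ⟨10, by
                    simp [closedCell, affineForm, exteriorCells]
                    constructorm* _ ∧ _ <;> linarith⟩
                · exact Or.inl ⟨3, by
                    simp [closedCell, affineForm, interiorCells]
                    constructorm* _ ∧ _ <;> linarith⟩
              · exact Or.inr ⟨7, by
                  simp [closedCell, affineForm, exteriorCells]
                  constructorm* _ ∧ _ <;> linarith⟩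
          · exact Or.inr ⟨5, by
              simp [closedCell, affineForm, exteriorCells]
              constructorm* _ ∧ _ <;> linarith⟩
        · rcases le_total 0 (2 * x - 3 * y - 15) with h | h
          · exact Or.inr ⟨9, by
              simp [closedCell, affineForm, exteriorCells]
              constructorm* _ ∧ _ <;> linarith⟩
          · rcases le_total 0 (2 * x + 3 * y - 8) with h | h
            · rcases le_total 0 (5 * x - 11 * y - 20) with h | h
              · exact Or.inr ⟨8, by
                  simp [closedCell, affineForm, exteriorCells]
                  constructorm* _ ∧ _ <;> linarith⟩
              · rcases le_total 0 (5 * x + 7 * y - 20) with h | h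
                · exact Or.inl ⟨1, by
                    simp [closedCell, affineForm, interiorCells]
                    constructorm* _ ∧ _ <;> linarith⟩
                · exact Or.inr ⟨6, by
                    simp [closedCell, affineForm, exteriorCells]
                    constructorm* _ ∧ _ <;> linarith⟩
            · exact Or.inr ⟨5, by
                simp [closedCell, affineForm, exteriorCells]
                constructorm* _ ∧ _ <;> linarith⟩
    · exact Or.inr ⟨3, by
        simp [closedCell, affineForm, exteriorCells]
        constructorm* _ ∧ _ <;> linarith⟩
  · rcases le_total 0 (x + y - 2) with h | h
    · rcases le_total 0 (5 * x + 7 * y - 20) with h | h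
      · exact Or.inl ⟨1, by
          simp [closedCell, affineForm, interiorCells]
          constructorm* _ ∧ _ <;> linarith⟩
      · exact Or.inr ⟨6, by
          simp [closedCell, affineForm, exteriorCells]
          constructorm* _ ∧ _ <;> linarith⟩
    · rcases le_total 0 (8 * x - 3 * y + 4) with h | h
      · exact Or.inr ⟨3, by
          simp [closedCell, affineForm, exteriorCells]
          constructorm* _ ∧ _ <;> linarith⟩
      · rcases le_total 0 (16 * x - 3 * y + 44) with h | h
        · exact Or.inr ⟨4, by
            simp [closedCell, affineForm, exteriorCells]
            constructorm* _ ∧ _ <;> linarith⟩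
        · exact Or.inl ⟨0, by
            simp [closedCell, affineForm, interiorCells]
            constructorm* _ ∧ _ <;> linarith⟩

theorem closedCell_interiorCells_subset (i : Fin 7) :
    closedCell (interiorCells i) ⊆ boundary ∪ ⋃ k, openCell (interiorCells k) := by
  rintro ⟨x, y⟩ hp
  rw [Set.mem_union, Set.mem_iUnion]
  by_cases hi : (x, y) ∈ openCell (interiorCells i)
  · exact Or.inr ⟨i, hi⟩
  obtain ⟨h, hh, hle⟩ : ∃ h ∈ interiorCells i, affineForm h (x, y) ≤ 0 := by
    simpa [openCell] using hi
  clear hi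
  have h0 := hle.antisymm (hp h hh)
  clear hle
  revert h
  fin_cases i <;> simp [closedCell, affineForm, interiorCells] at hp ⊢ <;>
    constructorm* _ ∧ _ <;> intro h0
  · exact Or.inl (mem_boundary 9 (-5, -12) (-5, 44) rfl rfl
      (by norm_num; linarith) (by norm_num; linarith) (by norm_num; linarith))
  · exact Or.inl (mem_boundary 8 (-2, 4) (-5, -12) rfl rfl
      (by norm_num; linarith) (by norm_num; linarith) (by norm_num; linarith))
  · rcases le_or_gt x (-5) with hx | hx
    · exact Or.inl (mem_boundary 9 (-5, -12) (-5, 44) rfl rfl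
        (by norm_num; linarith) (by norm_num; linarith) (by norm_num; linarith))
    · rcases lt_or_ge x (-3) with hx | hx
      · exact Or.inr ⟨1, by simp [openCell, affineForm]; constructorm* _ ∧ _ <;> linarith⟩
      · exact Or.inl (mem_boundary 7 (-3, 5) (-2, 4) rfl rfl
          (by norm_num; linarith) (by norm_num; linarith) (by norm_num; linarith))
  · rcases le_or_gt x (-5) with hx | hx
    · exact Or.inl (mem_boundary 9 (-5, -12) (-5, 44) rfl rfl
        (by norm_num; linarith) (by norm_num; linarith) (by norm_num; linarith))
    · rcases lt_or_ge x (-3) with hx | hx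
      · exact Or.inr ⟨0, by simp [openCell, affineForm]; constructorm* _ ∧ _ <;> linarith⟩
      · exact Or.inl (mem_boundary 6 (4, 0) (-3, 5) rfl rfl
          (by norm_num; linarith) (by norm_num; linarith) (by norm_num; linarith))
  · exact Or.inl (mem_boundary 5 (15, 5) (4, 0) rfl rfl
      (by norm_num; linarith) (by norm_num; linarith) (by norm_num; linarith))
  · rcases le_or_gt x (17) with hx | hx
    · exact Or.inl (mem_boundary 4 (17, 10) (15, 5) rfl rfl
        (by norm_num; linarith) (by norm_num; linarith) (by norm_num; linarith))
    · rcases lt_or_ge x (6325/337) with hx | hx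
      · exact Or.inr ⟨2, by simp [openCell, affineForm]; constructorm* _ ∧ _ <;> linarith⟩
      · exact Or.inl (mem_boundary 10 (-5, 44) (40, -12) rfl rfl
          (by norm_num; linarith) (by norm_num; linarith) (by norm_num; linarith))
  · exact Or.inl (mem_boundary 10 (-5, 44) (40, -12) rfl rfl
      (by norm_num; linarith) (by norm_num; linarith) (by norm_num; linarith))
  · exact Or.inl (mem_boundary 9 (-5, -12) (-5, 44) rfl rfl
      (by norm_num; linarith) (by norm_num; linarith) (by norm_num; linarith))
  · rcases le_or_gt x (17) with hx | hx
    · exact Or.inl (mem_boundary 3 (15, -3) (17, 10) rfl rfl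
        (by norm_num; linarith) (by norm_num; linarith) (by norm_num; linarith))
    · rcases lt_or_ge x (12445/697) with hx | hx
      · exact Or.inr ⟨1, by simp [openCell, affineForm]; constructorm* _ ∧ _ <;> linarith⟩
      · exact Or.inl (mem_boundary 10 (-5, 44) (40, -12) rfl rfl
          (by norm_num; linarith) (by norm_num; linarith) (by norm_num; linarith))
  · rcases le_or_gt x (16) with hx | hx
    · exact Or.inl (mem_boundary 2 (16, -4) (15, -3) rfl rfl
        (by norm_num; linarith) (by norm_num; linarith) (by norm_num; linarith))
    · rcases lt_or_ge x (344/17) with hx | hx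
      · exact Or.inr ⟨3, by simp [openCell, affineForm]; constructorm* _ ∧ _ <;> linarith⟩
      · exact Or.inl (mem_boundary 11 (40, -12) (-2, -4) rfl rfl
          (by norm_num; linarith) (by norm_num; linarith) (by norm_num; linarith))
  · exact Or.inl (mem_boundary 10 (-5, 44) (40, -12) rfl rfl
      (by norm_num; linarith) (by norm_num; linarith) (by norm_num; linarith))
  · exact Or.inl (mem_boundary 11 (40, -12) (-2, -4) rfl rfl
      (by norm_num; linarith) (by norm_num; linarith) (by norm_num; linarith))
  · exact Or.inl (mem_boundary 0 (-2, -4) (9, 1) rfl rfl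
      (by norm_num; linarith) (by norm_num; linarith) (by norm_num; linarith))
  · rcases le_or_gt x (16) with hx | hx
    · exact Or.inl (mem_boundary 1 (9, 1) (16, -4) rfl rfl
        (by norm_num; linarith) (by norm_num; linarith) (by norm_num; linarith))
    · rcases lt_or_ge x (248/11) with hx | hx
      · exact Or.inr ⟨2, by simp [openCell, affineForm]; constructorm* _ ∧ _ <;> linarith⟩
      · exact Or.inl (mem_boundary 11 (40, -12) (-2, -4) rfl rfl
          (by norm_num; linarith) (by norm_num; linarith) (by norm_num; linarith))
  · exact Or.inl (mem_boundary 11 (40, -12) (-2, -4) rfl rfl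
      (by norm_num; linarith) (by norm_num; linarith) (by norm_num; linarith))
  · rcases le_or_gt x (-5) with hx | hx
    · exact Or.inl (mem_boundary 8 (-2, 4) (-5, -12) rfl rfl
        (by norm_num; linarith) (by norm_num; linarith) (by norm_num; linarith))
    · rcases lt_or_ge x (-3) with hx | hx
      · exact Or.inr ⟨0, by simp [openCell, affineForm]; constructorm* _ ∧ _ <;> linarith⟩
      · exact Or.inl (mem_boundary 6 (4, 0) (-3, 5) rfl rfl
          (by norm_num; linarith) (by norm_num; linarith) (by norm_num; linarith))
  · exact Or.inl (mem_boundary 9 (-5, -12) (-5, 44) rfl rfl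
      (by norm_num; linarith) (by norm_num; linarith) (by norm_num; linarith))
  · rcases le_or_gt x (-5) with hx | hx
    · exact Or.inl (mem_boundary 9 (-5, -12) (-5, 44) rfl rfl
        (by norm_num; linarith) (by norm_num; linarith) (by norm_num; linarith))
    · rcases lt_or_ge x (-3) with hx | hx
      · exact Or.inr ⟨1, by simp [openCell, affineForm]; constructorm* _ ∧ _ <;> linarith⟩
      · exact Or.inl (mem_boundary 6 (4, 0) (-3, 5) rfl rfl
          (by norm_num; linarith) (by norm_num; linarith) (by norm_num; linarith))
  · rcases le_or_gt x (-2) with hx | hx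
    · exact Or.inl (mem_boundary 0 (-2, -4) (9, 1) rfl rfl
        (by norm_num; linarith) (by norm_num; linarith) (by norm_num; linarith))
    · rcases lt_or_ge x (16) with hx | hx
      · exact Or.inr ⟨3, by simp [openCell, affineForm]; constructorm* _ ∧ _ <;> linarith⟩
      · exact Or.inl (mem_boundary 1 (9, 1) (16, -4) rfl rfl
          (by norm_num; linarith) (by norm_num; linarith) (by norm_num; linarith))
  · rcases le_or_gt x (16) with hx | hx
    · exact Or.inl (mem_boundary 1 (9, 1) (16, -4) rfl rfl
        (by norm_num; linarith) (by norm_num; linarith) (by norm_num; linarith))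
    · rcases lt_or_ge x (40) with hx | hx
      · exact Or.inr ⟨2, by simp [openCell, affineForm]; constructorm* _ ∧ _ <;> linarith⟩
      · exact Or.inl (mem_boundary 10 (-5, 44) (40, -12) rfl rfl
          (by norm_num; linarith) (by norm_num; linarith) (by norm_num; linarith))
  · exact Or.inl (mem_boundary 11 (40, -12) (-2, -4) rfl rfl
      (by norm_num; linarith) (by norm_num; linarith) (by norm_num; linarith))
  · rcases le_or_gt x (-5) with hx | hx
    · exact Or.inl (mem_boundary 9 (-5, -12) (-5, 44) rfl rfl
        (by norm_num; linarith) (by norm_num; linarith) (by norm_num; linarith))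
    · rcases lt_or_ge x (17) with hx | hx
      · exact Or.inr ⟨1, by simp [openCell, affineForm]; constructorm* _ ∧ _ <;> linarith⟩
      · exact Or.inl (mem_boundary 3 (15, -3) (17, 10) rfl rfl
          (by norm_num; linarith) (by norm_num; linarith) (by norm_num; linarith))
  · exact Or.inl (mem_boundary 10 (-5, 44) (40, -12) rfl rfl
      (by norm_num; linarith) (by norm_num; linarith) (by norm_num; linarith))
  · rcases le_or_gt x (17) with hx | hx
    · exact Or.inl (mem_boundary 3 (15, -3) (17, 10) rfl rfl
        (by norm_num; linarith) (by norm_num; linarith) (by norm_num; linarith))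
    · rcases lt_or_ge x (40) with hx | hx
      · exact Or.inr ⟨2, by simp [openCell, affineForm]; constructorm* _ ∧ _ <;> linarith⟩
      · exact Or.inl (mem_boundary 10 (-5, 44) (40, -12) rfl rfl
          (by norm_num; linarith) (by norm_num; linarith) (by norm_num; linarith))

set_option maxHeartbeats 2000000 in
theorem disjoint_exteriorCells (j : Fin 12) :
    Disjoint (openCell (exteriorCells j)) (cellUnion interiorCells) := by
  refine Set.disjoint_left.2 ?_
  rintro ⟨x, y⟩ hj hp
  obtain ⟨i, hi⟩ := Set.mem_iUnion.1 hp
  fin_cases i <;> simp [closedCell, affineForm, interiorCells] at hi <;>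
    fin_cases j <;> simp [openCell, affineForm, exteriorCells] at hj <;>
    linarith

theorem openCell_interiorCells_nonempty (i : Fin 7) : (openCell (interiorCells i)).Nonempty := by
  refine ⟨_, toPlane_mem_openCell
    (a := ![(-3, 0), (0, 3), (16, 0), (0, -4), (-4, 0), (4, -5), (16, 12)] i) ?_⟩
  decide +revert

theorem openCell_exteriorCells_nonempty (j : Fin 12) : (openCell (exteriorCells j)).Nonempty := by
  refine (segment_inter_openCell_nonempty (s := 1) (t := 1)
    (a := ![(-6, 0), (28, 3), (0, -13), (0, -5), (-3, -2), (0, 0), (-1, 3), (0, -3), (7, 1), (10, 1), (14, -3), (16, 4)] j)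
    (b := ![(-6, 0), (28, 3), (0, -13), (0, -5), (-3, -2), (0, 0), (-1, 4), (0, -3), (7, 1), (10, 1), (14, -2), (16, 4)] j)
    one_pos one_pos ?_).right
  decide +revert

theorem boundary_subset_cellUnion {ι : Type*} {L : ι → List (ℤ × ℤ × ℤ)}
    (h : ∀ i : ZMod 12, ∃ k, ∀ f ∈ L k,
      0 ≤ f.1 * (vertexCoord i).1 + f.2.1 * (vertexCoord i).2 + f.2.2 ∧
      0 ≤ f.1 * (vertexCoord (i + 1)).1 + f.2.1 * (vertexCoord (i + 1)).2 + f.2.2) :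
    boundary ⊆ cellUnion L := by
  refine Set.iUnion_subset fun i => ?_
  obtain ⟨k, hk⟩ := h i
  exact ((convex_closedCell (L k)).segment_subset
    (toPlane_mem_closedCell fun f hf => (hk f hf).1)
    (toPlane_mem_closedCell fun f hf => (hk f hf).2)).trans
    (Set.subset_iUnion (fun k => closedCell (L k)) k)

theorem isCompact_cellUnion_interiorCells : IsCompact (cellUnion interiorCells) := by
  refine isCompact_Icc.of_isClosed_subset (s := Set.Icc ((-5, -12) : ℝ × ℝ) (40, 44))
    isClosed_cellUnion (Set.iUnion_subset fun i => ?_)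
  rintro ⟨x, y⟩ hp
  rw [Set.mem_Icc, Prod.mk_le_mk, Prod.mk_le_mk]
  fin_cases i <;> simp [closedCell, affineForm, interiorCells] at hp <;>
    refine ⟨⟨?_, ?_⟩, ?_, ?_⟩ <;> linarith

theorem isSimplePolygon_vertexCoord :
    IsSimplePolygon 12 (fun i => toPlane (vertexCoord i)) (cellUnion interiorCells) := by
  refine ⟨by norm_num, toPlane_injective.comp (by decide), fun i => ?_, fun i j h₁ h₂ h₃ => ?_,
    isCompact_cellUnion_interiorCells,
    cellUnion_eq_closure_interior openCell_interiorCells_nonempty,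
    frontier_cellUnion openCell_exteriorCells_nonempty disjoint_exteriorCells
      (boundary_subset_cellUnion (by decide)) (boundary_subset_cellUnion (by decide))
      closedCell_interiorCells_subset⟩
  · refine segment_inter_segment_eq_singleton ?_
    rw [cross_toPlane, Int.cast_ne_zero]
    exact (by decide : ∀ i, cross (vertexCoord i) (vertexCoord (i + 1)) (vertexCoord (i + 2)) ≠ 0) i
  · have h : ∀ i j : ZMod 12, j ≠ i → j ≠ i + 1 → i ≠ j + 1 →
        0 < cross (vertexCoord i) (vertexCoord (i + 1)) (vertexCoord j) *
          cross (vertexCoord i) (vertexCoord (i + 1)) (vertexCoord (j + 1)) ∨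
        0 < cross (vertexCoord j) (vertexCoord (j + 1)) (vertexCoord i) *
          cross (vertexCoord j) (vertexCoord (j + 1)) (vertexCoord (i + 1)) := by
      decide
    rcases h i j h₁ h₂ h₃ with h | h
    · refine segment_inter_segment_eq_empty ?_
      rw [cross_toPlane, cross_toPlane]
      exact_mod_cast h
    · rw [Set.inter_comm]
      refine segment_inter_segment_eq_empty ?_
      rw [cross_toPlane, cross_toPlane]
      exact_mod_cast h

/-- A point outside the 12-gon that sees no vertex of the same parity as `i`. -/
def hiddenPoint (i : ZMod 12) : ℤ × ℤ := if i.val % 2 = 0 then (13, 1) else (0, 0)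

theorem hiddenPoint_notMem (i : ZMod 12) : toPlane (hiddenPoint i) ∉ cellUnion interiorCells := by
  have h : ∀ i, ∃ j, ∀ f ∈ exteriorCells j,
      0 < f.1 * (hiddenPoint i).1 + f.2.1 * (hiddenPoint i).2 + f.2.2 := by
    decide
  obtain ⟨j, hj⟩ := h i
  exact (disjoint_exteriorCells j).notMem_of_mem_left (toPlane_mem_openCell hj)

theorem segment_hiddenPoint_inter_interior (i : ZMod 12) :
    (segment ℝ (toPlane (hiddenPoint i)) (toPlane (vertexCoord i)) ∩
      interior (cellUnion interiorCells)).Nonempty := by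
  have h : ∀ i, ∃ w ∈ ([(1, 1), (1, 3), (2, 1)] : List (ℤ × ℤ)), ∃ k, 0 < w.1 ∧ 0 < w.2 ∧
      ∀ f ∈ interiorCells k,
        0 < w.1 * (f.1 * (hiddenPoint i).1 + f.2.1 * (hiddenPoint i).2 + f.2.2) +
          w.2 * (f.1 * (vertexCoord i).1 + f.2.1 * (vertexCoord i).2 + f.2.2) := by
    decide
  obtain ⟨w, -, k, hs, ht, hk⟩ := h i
  exact (segment_inter_openCell_nonempty hs ht hk).mono
    (Set.inter_subset_inter_right _ (openCell_subset_interior_cellUnion k))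

theorem segment_inter_interior_eq_empty {X g : ℝ × ℝ} {j : Fin 12}
    (hX : X ∈ closedCell (exteriorCells j)) (hg : g ∈ closedCell (exteriorCells j)) :
    segment ℝ X g ∩ interior (cellUnion interiorCells) = ∅ :=
  Set.disjoint_iff_inter_eq_empty.1 <|
    (disjoint_closedCell_interior (openCell_exteriorCells_nonempty j)
      (disjoint_exteriorCells j)).mono_left ((convex_closedCell _).segment_subset hX hg)

/-- There is a simple 12-gon such that the every-second-vertex guard placement
always fails, and yet the exterior can be guarded by 4 guards. -/
theorem exists_twelve_gon_guards_fail_but_four_suffice :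
    ∃ (v : ZMod 12 → ℝ × ℝ) (P : Set (ℝ × ℝ)), IsSimplePolygon 12 v P ∧
      (∀ k : ZMod 12, ∃ X : ℝ × ℝ, X ∉ P ∧
        ∀ g ∈ EverySecondGuards 12 v k, (segment ℝ X g ∩ interior P).Nonempty) ∧
      ∃ g₁ g₂ g₃ g₄ : ℝ × ℝ, ∀ X : ℝ × ℝ, X ∉ P →
        segment ℝ X g₁ ∩ interior P = ∅ ∨ segment ℝ X g₂ ∩ interior P = ∅ ∨
        segment ℝ X g₃ ∩ interior P = ∅ ∨ segment ℝ X g₄ ∩ interior P = ∅ := by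
  refine ⟨fun i => toPlane (vertexCoord i), cellUnion interiorCells,
    isSimplePolygon_vertexCoord, fun k => ⟨_, hiddenPoint_notMem k, ?_⟩,
    toPlane (vertexCoord 10), toPlane (vertexCoord 9), toPlane (vertexCoord 6),
    toPlane (vertexCoord 3), fun X hX => ?_⟩
  · rintro _ ⟨j, hj, rfl⟩
    have h : ∀ k : ZMod 12, ∀ j < 6, hiddenPoint (k + ((2 * j : ℕ) : ZMod 12)) = hiddenPoint k := by
      decide
    rw [← h k j hj]
    exact segment_hiddenPoint_inter_interior _
  · obtain ⟨i, hi⟩ | ⟨j, hj⟩ := mem_interiorCells_or_mem_exteriorCells X.1 X.2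
    · exact (hX (Set.mem_iUnion.2 ⟨i, hi⟩)).elim
    have h : ∀ j, ∃ i ∈ ([10, 9, 6, 3] : List (ZMod 12)), ∀ f ∈ exteriorCells j,
        0 ≤ f.1 * (vertexCoord i).1 + f.2.1 * (vertexCoord i).2 + f.2.2 := by
      decide
    obtain ⟨i, hi, hij⟩ := h j
    have hvis := segment_inter_interior_eq_empty hj (toPlane_mem_closedCell hij)
    simp only [List.mem_cons, List.not_mem_nil, or_false] at hi
    rcases hi with rfl | rfl | rfl | rfl <;> simp [hvis]
end

section
/- There exists a polyhedron in ℝ³ with exactly 24 vertices and exactly 26 faces whose interior is not guarded by placing a guard at every vertex: there is a point q in the interior of the polyhedral region P such that for every vertex v of the polyhedron, the closed segment [q, v] is not contained in P. (The Überoctoplex — a 20×20×20 cube with a trapezoidal prism cut from each of its six sides and its eight corners sliced off by planes — is such a polyhedron, and it has both fewer vertices and fewer faces than the Octoplex, which has 56 vertices and 30 faces.) -/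
/-- A polyhedron in `ℝ³`: a compact region `P` equal to the closure of its interior,
together with `m` faces `F 0, …, F (m-1)`, where each face is the convex hull of a
finite set of points, spans a (2-dimensional) affine plane of `ℝ³` — so it lies in a
plane and has nonempty interior relative to that plane — the faces have pairwise
disjoint relative (intrinsic) interiors, and the frontier of `P` is the union of the
faces. -/
def IsPolyhedron (m : ℕ) (F : Fin m → Set (EuclideanSpace ℝ (Fin 3)))
    (P : Set (EuclideanSpace ℝ (Fin 3))) : Prop :=
  IsCompact P ∧
  P = closure (interior P) ∧
  (∀ i, ∃ S : Finset (EuclideanSpace ℝ (Fin 3)), F i = convexHull ℝ (S : Set _)) ∧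
  (∀ i, Module.finrank ℝ (affineSpan ℝ (F i)).direction = 2) ∧
  (∀ i j, i ≠ j → intrinsicInterior ℝ (F i) ∩ intrinsicInterior ℝ (F j) = ∅) ∧
  frontier P = ⋃ i, F i

/-- The vertices of a polyhedron: points belonging to at least three of the faces. -/
def polyhedronVertices (m : ℕ) (F : Fin m → Set (EuclideanSpace ℝ (Fin 3))) :
    Set (EuclideanSpace ℝ (Fin 3)) :=
  {x | ∃ i j k : Fin m, i ≠ j ∧ i ≠ k ∧ j ≠ k ∧ x ∈ F i ∧ x ∈ F j ∧ x ∈ F k}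

namespace Uberoctoplex

/-- The sign `±1` encoded by a Boolean. -/
def sg (a : Bool) : ℝ := if a then 1 else -1

@[simp] lemma sg_true : sg true = 1 := rfl
@[simp] lemma sg_false : sg false = -1 := rfl

lemma sg_mul_eq_abs {a : Bool} {x : ℝ} (h : 0 ≤ sg a * x) : sg a * x = |x| := by
  cases a <;> simp [sg] at h ⊢
  · rw [abs_of_nonpos h]
  · rw [abs_of_nonneg h]

lemma exists_sg_mul_eq_abs (x : ℝ) : ∃ a, sg a * x = |x| := by
  rcases le_total 0 x with h | h
  · exact ⟨true, by simp [sg, abs_of_nonneg h]⟩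
  · exact ⟨false, by simp [sg, abs_of_nonpos h]⟩

lemma sg_unique {a b : Bool} {x : ℝ} (ha : 0 < sg a * x) (hb : 0 < sg b * x) : a = b := by
  cases a <;> cases b <;> simp [sg] at * <;> linarith

lemma abs_sg (a : Bool) : |sg a| = 1 := by cases a <;> simp [sg]

lemma sg_ne_zero (a : Bool) : sg a ≠ 0 := by cases a <;> simp [sg]

lemma sg_mul_sg_mul (a : Bool) (x : ℝ) : sg a * (sg a * x) = x := by
  cases a <;> simp [sg]

lemma sum_cyclic (f : Fin 3 → ℝ) (k : Fin 3) : ∑ i, f i = f k + f (k + 1) + f (k + 2) := by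
  fin_cases k <;> simp [Fin.sum_univ_three] <;> ring

lemma add_one_add_one (k : Fin 3) : k + 1 + 1 = k + 2 := by decide +revert
lemma add_one_add_two (k : Fin 3) : k + 1 + 2 = k := by decide +revert
lemma add_two_add_one (k : Fin 3) : k + 2 + 1 = k := by decide +revert
lemma add_two_add_two (k : Fin 3) : k + 2 + 2 = k + 1 := by decide +revert

lemma eq_cyclic (k l : Fin 3) : l = k ∨ l = k + 1 ∨ l = k + 2 := by decide +revert

lemma forall_cyclic {Q : Fin 3 → Prop} (k : Fin 3) (h₀ : Q k) (h₁ : Q (k + 1))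
    (h₂ : Q (k + 2)) : ∀ i, Q i := by
  intro i
  rcases eq_cyclic k i with rfl | rfl | rfl <;> assumption

/-- The point with coordinates `x, y, z` at positions `k, k + 1, k + 2` (cyclically). -/
noncomputable def pt (k : Fin 3) (x y z : ℝ) : EuclideanSpace ℝ (Fin 3) :=
  WithLp.toLp 2 fun i => if i = k then x else if i = k + 1 then y else z

@[simp] lemma pt_zero (k : Fin 3) (x y z : ℝ) : pt k x y z k = x := by simp [pt]
@[simp] lemma pt_one (k : Fin 3) (x y z : ℝ) : pt k x y z (k + 1) = y := by simp [pt]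
@[simp] lemma pt_two (k : Fin 3) (x y z : ℝ) : pt k x y z (k + 2) = z := by
  have h₁ : k + 2 ≠ k := by decide +revert
  have h₂ : k + 2 ≠ k + 1 := by decide +revert
  simp [pt, h₁, h₂]

lemma ext_cyclic {p q : EuclideanSpace ℝ (Fin 3)} (k : Fin 3) (h₀ : p k = q k)
    (h₁ : p (k + 1) = q (k + 1)) (h₂ : p (k + 2) = q (k + 2)) : p = q :=
  PiLp.ext (forall_cyclic k h₀ h₁ h₂)

/-- The solid. -/
def solid : Set (EuclideanSpace ℝ (Fin 3)) :=
  {p | ∑ i, |p i| ≤ 16 ∧ ∀ k, |p k| ≤ 4 ∨ |p k| + 2 ≤ 3 * |p (k + 2)|}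

/-- The strict version of `solid`, an open dense subset of it. -/
def openSolid : Set (EuclideanSpace ℝ (Fin 3)) :=
  {p | ∑ i, |p i| < 16 ∧ ∀ k, |p k| < 4 ∨ |p k| + 2 < 3 * |p (k + 2)|}

/-- The bottom of a trench. -/
def rect (k : Fin 3) (a : Bool) : Set (EuclideanSpace ℝ (Fin 3)) :=
  {p | sg a * p k = 4 ∧ |p (k + 1)| ≤ 10 ∧ |p (k + 2)| ≤ 2}

/-- The wall of a trench. -/
def trap (k : Fin 3) (a b : Bool) : Set (EuclideanSpace ℝ (Fin 3)) :=
  {p | 3 * (sg b * p (k + 2)) = sg a * p k + 2 ∧ 4 ≤ sg a * p k ∧ sg a * p k ≤ 10 ∧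
    |p (k + 1)| + sg a * p k + sg b * p (k + 2) ≤ 16}

/-- The triangle cutting off a corner of the cube. -/
def tri (s : Fin 3 → Bool) : Set (EuclideanSpace ℝ (Fin 3)) :=
  {p | ∑ i, sg (s i) * p i = 16 ∧
    ∀ k, sg (s k) * p k + 2 ≤ 3 * (sg (s (k + 2)) * p (k + 2))}

/-- The index type of the faces. -/
abbrev Idx := (Fin 3 × Bool) ⊕ (Fin 3 × Bool × Bool) ⊕ (Fin 3 → Bool)

/-- The faces of the solid. -/
def face : Idx → Set (EuclideanSpace ℝ (Fin 3))
  | .inl (k, a) => rect k a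
  | .inr (.inl (k, a, b)) => trap k a b
  | .inr (.inr s) => tri s

/-- The vertices of the solid. -/
noncomputable def vert (v : Fin 3 × (Fin 3 → Bool)) : EuclideanSpace ℝ (Fin 3) :=
  pt v.1 (sg (v.2 v.1) * 10) (sg (v.2 (v.1 + 1)) * 2) (sg (v.2 (v.1 + 2)) * 4)

lemma rect_abs {p k a} (h : p ∈ rect k a) :
    |p k| = 4 ∧ |p (k + 1)| ≤ 10 ∧ |p (k + 2)| ≤ 2 :=
  ⟨by rw [← sg_mul_eq_abs (a := a) (by rw [h.1]; norm_num), h.1], h.2⟩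

lemma trap_abs {p k a b} (h : p ∈ trap k a b) :
    3 * |p (k + 2)| = |p k| + 2 ∧ 4 ≤ |p k| ∧ |p k| ≤ 10 ∧ ∑ i, |p i| ≤ 16 := by
  obtain ⟨h₁, h₂, h₃, h₄⟩ := h
  rw [sum_cyclic _ k, ← sg_mul_eq_abs (a := a) (x := p k) (by linarith),
    ← sg_mul_eq_abs (a := b) (x := p (k + 2)) (by linarith)]
  exact ⟨h₁, h₂, h₃, by linarith⟩

lemma tri_pos {p s} (h : p ∈ tri s) (k : Fin 3) : 2 ≤ sg (s k) * p k := by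
  obtain ⟨h, h'⟩ := h
  have h₀ := h' k
  have h₁ := h' (k + 1)
  have h₂ := h' (k + 2)
  rw [sum_cyclic _ k] at h
  simp only [add_one_add_two, add_two_add_two] at *
  linarith

lemma tri_abs {p s} (h : p ∈ tri s) :
    ∑ i, |p i| = 16 ∧ ∀ k, |p k| + 2 ≤ 3 * |p (k + 2)| := by
  have h' : ∀ k, |p k| = sg (s k) * p k := fun k =>
    (sg_mul_eq_abs (by linarith [tri_pos h k])).symm
  simp only [h']
  exact h

lemma isClosed_solid : IsClosed solid := by
  have h : solid = {p | ∑ i, |p i| ≤ 16} ∩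
      ⋂ k, ({p | |p k| ≤ 4} ∪ {p | |p k| + 2 ≤ 3 * |p (k + 2)|}) := by
    ext p; simp [solid]
  rw [h]
  refine (isClosed_le (by fun_prop) (by fun_prop)).inter (isClosed_iInter fun k => ?_)
  exact (isClosed_le (by fun_prop) (by fun_prop)).union
    (isClosed_le (by fun_prop) (by fun_prop))

lemma isOpen_openSolid : IsOpen openSolid := by
  have h : openSolid = {p | ∑ i, |p i| < 16} ∩
      ⋂ k, ({p | |p k| < 4} ∪ {p | |p k| + 2 < 3 * |p (k + 2)|}) := by
    ext p; simp [openSolid]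
  rw [h]
  refine (isOpen_lt (by fun_prop) (by fun_prop)).inter (isOpen_iInter_of_finite fun k => ?_)
  exact (isOpen_lt (by fun_prop) (by fun_prop)).union
    (isOpen_lt (by fun_prop) (by fun_prop))

lemma isCompact_solid : IsCompact solid := by
  refine Metric.isCompact_of_isClosed_isBounded isClosed_solid
    (Metric.isBounded_closedBall (x := 0) (r := 16) |>.subset fun p hp => ?_)
  rw [mem_closedBall_zero_iff, EuclideanSpace.norm_eq]
  refine Real.sqrt_le_iff.2 ⟨by norm_num, ?_⟩
  have h := hp.1
  simp only [Fin.sum_univ_three, Real.norm_eq_abs] at h ⊢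
  nlinarith [abs_nonneg (p 0), abs_nonneg (p 1), abs_nonneg (p 2),
    mul_nonneg (abs_nonneg (p 0)) (abs_nonneg (p 1)),
    mul_nonneg (abs_nonneg (p 0)) (abs_nonneg (p 2)),
    mul_nonneg (abs_nonneg (p 1)) (abs_nonneg (p 2))]

lemma openSolid_subset : openSolid ⊆ solid := fun _ hp =>
  ⟨hp.1.le, fun k => (hp.2 k).imp le_of_lt le_of_lt⟩

lemma openSolid_subset_interior : openSolid ⊆ interior solid :=
  interior_maximal openSolid_subset isOpen_openSolid

open Filter Topology in
lemma mem_closure_of_path {U : Set (EuclideanSpace ℝ (Fin 3))} {p : EuclideanSpace ℝ (Fin 3)}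
    (k : Fin 3) (a b c r : ℝ) (hr : 0 < r)
    (h : ∀ ε, 0 < ε → ε < r →
      pt k ((1 - a * ε) * p k) ((1 - b * ε) * p (k + 1)) ((1 - c * ε) * p (k + 2)) ∈ U) :
    p ∈ closure U := by
  have hcont : Continuous fun ε : ℝ =>
      pt k ((1 - a * ε) * p k) ((1 - b * ε) * p (k + 1)) ((1 - c * ε) * p (k + 2)) := by
    unfold pt
    refine (PiLp.continuous_toLp 2 _).comp (continuous_pi fun i => ?_)
    split_ifs <;> fun_prop
  have hlim := (hcont.tendsto 0).mono_left (nhdsWithin_le_nhds (s := Set.Ioi 0))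
  have h0 : pt k ((1 - a * 0) * p k) ((1 - b * 0) * p (k + 1)) ((1 - c * 0) * p (k + 2)) = p := by
    apply ext_cyclic k <;> simp
  rw [h0] at hlim
  refine mem_closure_of_tendsto hlim ?_
  filter_upwards [Ioo_mem_nhdsGT hr] with ε hε using h ε hε.1 hε.2

lemma mem_openSolid_pt {k : Fin 3} {x y z : ℝ} :
    pt k x y z ∈ openSolid ↔ |x| + |y| + |z| < 16 ∧ (|x| < 4 ∨ |x| + 2 < 3 * |z|) ∧
      (|y| < 4 ∨ |y| + 2 < 3 * |x|) ∧ (|z| < 4 ∨ |z| + 2 < 3 * |y|) := by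
  have h := @forall_cyclic (fun i => |pt k x y z i| < 4 ∨
    |pt k x y z i| + 2 < 3 * |pt k x y z (i + 2)|) k
  simp only [pt_zero, pt_one, pt_two, add_one_add_two, add_two_add_two] at h
  simp only [openSolid, Set.mem_ofPred_eq, sum_cyclic _ k, pt_zero, pt_one, pt_two]
  refine and_congr_right fun _ => ⟨fun H => ?_, fun H => h H.1 H.2.1 H.2.2⟩
  have h₀ := H k
  have h₁ := H (k + 1)
  have h₂ := H (k + 2)
  simp only [pt_zero, pt_one, pt_two, add_one_add_two, add_two_add_two] at h₀ h₁ h₂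
  exact ⟨h₀, h₁, h₂⟩

lemma mem_solid_iff {p : EuclideanSpace ℝ (Fin 3)} (k : Fin 3) :
    p ∈ solid ↔ |p k| + |p (k + 1)| + |p (k + 2)| ≤ 16 ∧
      (|p k| ≤ 4 ∨ |p k| + 2 ≤ 3 * |p (k + 2)|) ∧
      (|p (k + 1)| ≤ 4 ∨ |p (k + 1)| + 2 ≤ 3 * |p k|) ∧
      (|p (k + 2)| ≤ 4 ∨ |p (k + 2)| + 2 ≤ 3 * |p (k + 1)|) := by
  have h := @forall_cyclic (fun i => |p i| ≤ 4 ∨ |p i| + 2 ≤ 3 * |p (i + 2)|) k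
  simp only [add_one_add_two, add_two_add_two] at h
  simp only [solid, Set.mem_ofPred_eq, sum_cyclic _ k]
  refine and_congr_right fun _ => ⟨fun H => ?_, fun H => h H.1 H.2.1 H.2.2⟩
  have h₀ := H k
  have h₁ := H (k + 1)
  have h₂ := H (k + 2)
  simp only [add_one_add_two, add_two_add_two] at h₁ h₂
  exact ⟨h₀, h₁, h₂⟩

lemma solid_subset_closure : solid ⊆ closure openSolid := by
  intro p hp
  have hstep : ∀ k : Fin 3, 4 < |p k| → |p (k + 1)| ≤ 4 → p ∈ closure openSolid := by
    intro k hx hy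
    refine mem_closure_of_path k 27 1 3 (1 / 27) (by norm_num) fun ε hε hε' => ?_
    rw [mem_openSolid_pt]
    rw [mem_solid_iff k] at hp
    obtain ⟨hs, h₀, -, h₂⟩ := hp
    replace h₀ := h₀.resolve_left hx.not_ge
    simp only [abs_mul, abs_of_pos (show 0 < 1 - 27 * ε by linarith),
      abs_of_pos (show 0 < 1 - 1 * ε by linarith), abs_of_pos (show 0 < 1 - 3 * ε by linarith)]
    have := abs_nonneg (p (k + 1))
    have := abs_nonneg (p (k + 2))
    generalize |p k| = x at *
    generalize |p (k + 1)| = y at *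
    generalize |p (k + 2)| = z at *
    refine ⟨by nlinarith, .inr (by nlinarith), .inl (by nlinarith), ?_⟩
    rcases le_or_gt z 4 with hz | hz
    · exact .inl (by nlinarith)
    · exact .inr (by nlinarith [h₂.resolve_left hz.not_ge])
  have hshrink : ((∀ k, |p k| ≤ 4) ∨ ∀ k, 4 < |p k|) → p ∈ closure openSolid := by
    intro h
    refine mem_closure_of_path 0 1 1 1 (1 / 2) (by norm_num) fun ε hε hε' => ?_
    rw [mem_openSolid_pt]
    rw [mem_solid_iff 0] at hp
    simp only [abs_mul, abs_of_pos (show 0 < 1 - 1 * ε by linarith)]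
    have hall : ∀ i, 0 ≤ |p i| := fun i => abs_nonneg _
    have := hall 0
    have := hall (0 + 1)
    have := hall (0 + 2)
    rcases h with h | h <;> have ha := h 0 <;> have hb := h (0 + 1) <;> have hc := h (0 + 2) <;>
      generalize |p 0| = x at * <;> generalize |p (0 + 1)| = y at * <;>
      generalize |p (0 + 2)| = z at *
    · exact ⟨by nlinarith, .inl (by nlinarith), .inl (by nlinarith), .inl (by nlinarith)⟩
    · obtain ⟨hs, -⟩ := hp
      exact ⟨by nlinarith, .inr (by nlinarith), .inr (by nlinarith), .inr (by nlinarith)⟩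
  by_cases h : ∃ k : Fin 3, 4 < |p k| ∧ |p (k + 1)| ≤ 4
  · obtain ⟨k, h, h'⟩ := h
    exact hstep k h h'
  · push Not at h
    refine hshrink ?_
    by_cases h' : ∃ k, 4 < |p k|
    · obtain ⟨k, hk⟩ := h'
      exact .inr (forall_cyclic k hk (h k hk) (by simpa [add_one_add_one] using h _ (h k hk)))
    · push Not at h'
      exact .inl h'

lemma solid_eq_closure_interior : solid = closure (interior solid) :=
  (solid_subset_closure.trans (closure_mono openSolid_subset_interior)).antisymm
    (closure_minimal interior_subset isClosed_solid)

lemma face_subset_solid (i : Idx) : face i ⊆ solid := by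
  intro p hp
  rcases i with ⟨k, a⟩ | ⟨k, a, b⟩ | s
  · obtain ⟨h₀, h₁, h₂⟩ := rect_abs hp
    rw [mem_solid_iff k]
    exact ⟨by linarith, .inl (by linarith), .inr (by linarith), .inl (by linarith)⟩
  · obtain ⟨h₀, h₁, h₂, h₃⟩ := trap_abs hp
    rw [sum_cyclic _ k] at h₃
    rw [mem_solid_iff k]
    exact ⟨by linarith, .inr (by linarith), .inr (by linarith), .inl (by linarith)⟩
  · exact ⟨(tri_abs hp).1.le, fun k => .inr ((tri_abs hp).2 k)⟩

lemma face_subset_closure_compl (i : Idx) : face i ⊆ closure solidᶜ := by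
  intro p hp
  rcases i with ⟨k, a⟩ | ⟨k, a, b⟩ | s
  · obtain ⟨h₀, h₁, h₂⟩ := rect_abs hp
    refine mem_closure_of_path k (-1) 0 0 1 (by norm_num) fun ε hε hε' => ?_
    rw [Set.mem_compl_iff, mem_solid_iff k]
    simp only [pt_zero, pt_one, pt_two, abs_mul, abs_of_pos (show 0 < 1 - -1 * ε by linarith)]
    norm_num
    intro _ h
    rcases h with h | h <;> nlinarith
  · obtain ⟨h₀, h₁, h₂, h₃⟩ := trap_abs hp
    refine mem_closure_of_path k (-1) 0 0 1 (by norm_num) fun ε hε hε' => ?_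
    rw [Set.mem_compl_iff, mem_solid_iff k]
    simp only [pt_zero, pt_one, pt_two, abs_mul, abs_of_pos (show 0 < 1 - -1 * ε by linarith)]
    norm_num
    intro _ h
    rcases h with h | h <;> nlinarith
  · obtain ⟨h, -⟩ := tri_abs hp
    rw [sum_cyclic _ 0] at h
    refine mem_closure_of_path 0 (-1) (-1) (-1) 1 (by norm_num) fun ε hε hε' => ?_
    rw [Set.mem_compl_iff, mem_solid_iff 0]
    simp only [pt_zero, pt_one, pt_two, abs_mul, abs_of_pos (show 0 < 1 - -1 * ε by linarith)]
    intro h'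
    nlinarith [h'.1]

lemma exists_mem_face {p : EuclideanSpace ℝ (Fin 3)} (hp : p ∈ solid) (hp' : p ∉ openSolid) :
    ∃ i, p ∈ face i := by
  choose s hs using fun k => exists_sg_mul_eq_abs (p k)
  by_cases h : ∃ k, 4 ≤ |p k| ∧ 3 * |p (k + 2)| ≤ |p k| + 2
  · obtain ⟨k, hk, hk'⟩ := h
    rw [mem_solid_iff k] at hp
    obtain ⟨h, h₀, h₁, h₂⟩ := hp
    by_cases h4 : |p k| = 4
    · refine ⟨.inl (k, s k), (hs k).trans h4, ?_, by linarith⟩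
      rcases h₁ with h₁ | h₁ <;> linarith
    · replace h₀ := h₀.resolve_left fun h => h4 (h.antisymm hk)
      refine ⟨.inr (.inl (k, s k, s (k + 2))), ?_⟩
      simp only [face, trap, Set.mem_ofPred_eq, hs]
      exact ⟨by linarith, hk, by rcases h₂ with h₂ | h₂ <;> linarith, by linarith⟩
  · push Not at h
    refine ⟨.inr (.inr s), ?_⟩
    simp only [face, tri, Set.mem_ofPred_eq, hs]
    have hsum : ∑ i, |p i| = 16 := by
      by_contra hne
      refine hp' ⟨lt_of_le_of_ne hp.1 hne, fun k => ?_⟩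
      rcases lt_or_ge (|p k|) 4 with h4 | h4
      · exact .inl h4
      · exact .inr (h k h4)
    refine ⟨hsum, fun k => ?_⟩
    rw [mem_solid_iff k] at hp
    rw [sum_cyclic _ k] at hsum
    obtain ⟨-, h₀, h₁, h₂⟩ := hp
    rcases h₀ with h₀ | h₀
    · rcases h₁ with h₁ | h₁ <;> rcases h₂ with h₂ | h₂ <;> linarith
    · exact h₀

lemma frontier_solid : frontier solid = ⋃ i, face i := by
  ext p
  rw [Set.mem_iUnion]
  constructor
  · intro hp
    exact exists_mem_face (isClosed_solid.frontier_subset hp)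
      fun h => hp.2 (openSolid_subset_interior h)
  · rintro ⟨i, hi⟩
    rw [frontier_eq_closure_inter_closure]
    exact ⟨subset_closure (face_subset_solid i hi), face_subset_closure_compl i hi⟩

open Filter Topology in
lemma exists_extend_of_mem_intrinsicInterior {E : Type*} [NormedAddCommGroup E]
    [NormedSpace ℝ E] {F : Set E} {p q : E} (hp : p ∈ intrinsicInterior ℝ F) (hq : q ∈ F) :
    ∃ ε : ℝ, 0 < ε ∧ p + ε • (p - q) ∈ F := by
  obtain ⟨y, hy, rfl⟩ := hp
  let γ : ℝ → affineSpan ℝ F := fun t =>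
    ⟨AffineMap.lineMap q (y : E) (1 + t), AffineMap.lineMap_mem _ (subset_affineSpan ℝ F hq) y.2⟩
  have hγ : Continuous γ := by
    refine Continuous.subtype_mk ?_ _
    simp only [AffineMap.lineMap_apply_module]
    fun_prop
  have h0 : γ 0 = y := by ext; simp [γ]
  have hev : ∀ᶠ t in 𝓝 (0 : ℝ), γ t ∈ interior ((↑) ⁻¹' F : Set (affineSpan ℝ F)) :=
    hγ.continuousAt.preimage_mem_nhds (isOpen_interior.mem_nhds (by rwa [h0]))
  obtain ⟨ε, hε, h⟩ := ((hev.filter_mono nhdsWithin_le_nhds).and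
    (self_mem_nhdsWithin (s := Set.Ioi (0 : ℝ)))).exists
  refine ⟨ε, h, ?_⟩
  have := interior_subset hε
  simp only [Set.mem_preimage, γ, AffineMap.lineMap_apply_module] at this
  convert this using 1
  module

lemma lt_of_mem_intrinsicInterior {E : Type*} [NormedAddCommGroup E]
    [NormedSpace ℝ E] {F : Set E} {p : E} (hp : p ∈ intrinsicInterior ℝ F) (f : E → ℝ) (c : ℝ)
    (hf : ConvexOn ℝ Set.univ f) (hF : ∀ x ∈ F, f x ≤ c) (hq : ∃ q ∈ F, f q < c) : f p < c := by
  obtain ⟨q, hq, hqc⟩ := hq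
  obtain ⟨ε, hε, h⟩ := exists_extend_of_mem_intrinsicInterior hp hq
  have hle' := hF _ h
  have hε' : 0 < 1 + ε := by linarith
  have hle : f ((1 / (1 + ε)) • (p + ε • (p - q)) + (ε / (1 + ε)) • q) ≤
      (1 / (1 + ε)) • f (p + ε • (p - q)) + (ε / (1 + ε)) • f q :=
    hf.2 (Set.mem_univ _) (Set.mem_univ _) (by positivity) (by positivity) (by field_simp)
  have heq : (1 / (1 + ε)) • (p + ε • (p - q)) + (ε / (1 + ε)) • q = p := by
    match_scalars <;> field_simp; ring
  rw [heq, smul_eq_mul, smul_eq_mul] at hle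
  calc f p ≤ _ := hle
    _ ≤ 1 / (1 + ε) * c + ε / (1 + ε) * f q := by gcongr
    _ < 1 / (1 + ε) * c + ε / (1 + ε) * c := by gcongr
    _ = c := by field_simp

lemma convexOn_abs_coord (k : Fin 3) :
    ConvexOn ℝ Set.univ fun p : EuclideanSpace ℝ (Fin 3) => |p k| := by
  refine ⟨convex_univ, fun x _ y _ a b ha hb _ => ?_⟩
  simp only [PiLp.add_apply, PiLp.smul_apply, smul_eq_mul]
  refine (abs_add_le _ _).trans_eq ?_
  rw [abs_mul, abs_mul, abs_of_nonneg ha, abs_of_nonneg hb]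

lemma convexOn_coord (k : Fin 3) (c : ℝ) :
    ConvexOn ℝ Set.univ fun p : EuclideanSpace ℝ (Fin 3) => c * p k := by
  refine ⟨convex_univ, fun x _ y _ a b ha hb _ => le_of_eq ?_⟩
  simp only [PiLp.add_apply, PiLp.smul_apply, smul_eq_mul]
  ring

lemma rect_strict {p k a} (hp : p ∈ intrinsicInterior ℝ (rect k a)) :
    sg a * p k = 4 ∧ |p (k + 1)| < 10 ∧ |p (k + 2)| < 2 := by
  have hq : pt k (sg a * 4) 0 0 ∈ rect k a := by
    simp only [rect, Set.mem_ofPred_eq, pt_zero, pt_one, pt_two, sg_mul_sg_mul]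
    norm_num
  refine ⟨(intrinsicInterior_subset hp).1, ?_, ?_⟩
  · exact lt_of_mem_intrinsicInterior hp (fun p => |p (k + 1)|) 10 (convexOn_abs_coord _)
      (fun x hx => hx.2.1) ⟨_, hq, by simp⟩
  · exact lt_of_mem_intrinsicInterior hp (fun p => |p (k + 2)|) 2 (convexOn_abs_coord _)
      (fun x hx => hx.2.2) ⟨_, hq, by simp⟩

lemma trap_strict {p k a b} (hp : p ∈ intrinsicInterior ℝ (trap k a b)) :
    3 * |p (k + 2)| = |p k| + 2 ∧ 4 < |p k| ∧ |p k| < 10 ∧ ∑ i, |p i| < 16 := by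
  have hq : pt k (sg a * 7) 0 (sg b * 3) ∈ trap k a b := by
    simp only [trap, Set.mem_ofPred_eq, pt_zero, pt_one, pt_two, sg_mul_sg_mul]
    norm_num
  obtain ⟨h₁, h₂, -⟩ := intrinsicInterior_subset hp
  rw [sum_cyclic _ k]
  rw [← sg_mul_eq_abs (a := a) (x := p k) (by linarith),
    ← sg_mul_eq_abs (a := b) (x := p (k + 2)) (by linarith)]
  refine ⟨h₁, ?_, ?_, ?_⟩
  · have := lt_of_mem_intrinsicInterior hp (fun p => (-sg a) * p k) (-4) (convexOn_coord _ _)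
      (fun x hx => by linarith [hx.2.1]) ⟨_, hq, by simp [sg_mul_sg_mul]; norm_num⟩
    linarith
  · exact lt_of_mem_intrinsicInterior hp (fun p => sg a * p k) 10 (convexOn_coord _ _)
      (fun x hx => by linarith [hx.2.2.1]) ⟨_, hq, by simp [sg_mul_sg_mul]; norm_num⟩
  · have := lt_of_mem_intrinsicInterior hp
      (fun p => |p (k + 1)| + sg a * p k + sg b * p (k + 2)) 16
      (((convexOn_abs_coord _).add (convexOn_coord _ _)).add (convexOn_coord _ _))
      (fun x hx => hx.2.2.2) ⟨_, hq, by simp [sg_mul_sg_mul]; norm_num⟩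
    linarith

lemma tri_strict {p s} (hp : p ∈ intrinsicInterior ℝ (tri s)) :
    ∑ i, |p i| = 16 ∧ ∀ k, |p k| + 2 < 3 * |p (k + 2)| := by
  refine ⟨(tri_abs (intrinsicInterior_subset hp)).1, fun k => ?_⟩
  have hq : pt 0 (sg (s 0) * (16 / 3)) (sg (s (0 + 1)) * (16 / 3)) (sg (s (0 + 2)) * (16 / 3)) ∈
      tri s := by
    refine ⟨?_, forall_cyclic 0 ?_ ?_ ?_⟩ <;>
      simp only [sum_cyclic _ 0, pt_zero, pt_one, pt_two, sg_mul_sg_mul, add_one_add_two,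
        add_two_add_two] <;> norm_num
  have hq' : ∀ k, sg (s k) * pt 0 (sg (s 0) * (16 / 3)) (sg (s (0 + 1)) * (16 / 3))
      (sg (s (0 + 2)) * (16 / 3)) k = 16 / 3 :=
    forall_cyclic 0 (by simp [sg_mul_sg_mul]) (by rw [pt_one, sg_mul_sg_mul])
      (by rw [pt_two, sg_mul_sg_mul])
  have := lt_of_mem_intrinsicInterior hp
      (fun p => sg (s k) * p k + (-3 * sg (s (k + 2))) * p (k + 2)) (-2)
      ((convexOn_coord _ _).add (convexOn_coord _ _))
      (fun x hx => by linarith [hx.2 k]) ⟨_, hq, by linarith [hq' k, hq' (k + 2)]⟩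
  have h := tri_pos (intrinsicInterior_subset hp)
  rw [← sg_mul_eq_abs (a := s k) (x := p k) (by linarith [h k]),
    ← sg_mul_eq_abs (a := s (k + 2)) (x := p (k + 2)) (by linarith [h (k + 2)])]
  linarith

lemma rect_inj {p k a b} (h : p ∈ rect k a) (h' : p ∈ rect k b) : a = b :=
  sg_unique (x := p k) (by linarith [h.1]) (by linarith [h'.1])

lemma trap_inj {p k a b a' b'} (h : p ∈ trap k a b) (h' : p ∈ trap k a' b') :
    a = a' ∧ b = b' :=
  ⟨sg_unique (x := p k) (by linarith [h.2.1]) (by linarith [h'.2.1]),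
    sg_unique (x := p (k + 2)) (by linarith [h.1, h.2.1]) (by linarith [h'.1, h'.2.1])⟩

lemma tri_inj {p s t} (h : p ∈ tri s) (h' : p ∈ tri t) : s = t :=
  funext fun k => sg_unique (x := p k) (by linarith [tri_pos h k]) (by linarith [tri_pos h' k])

/-- The absolute values of the coordinates are, up to a cyclic shift, `10, 2, 4`. -/
def IsVert (p : EuclideanSpace ℝ (Fin 3)) : Prop :=
  ∃ k, |p k| = 10 ∧ |p (k + 1)| = 2 ∧ |p (k + 2)| = 4

lemma isVert_iff {p} : IsVert p ↔ p ∈ Set.range vert := by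
  constructor
  · rintro ⟨k, h₀, h₁, h₂⟩
    choose s hs using fun k => exists_sg_mul_eq_abs (p k)
    refine ⟨(k, s), ext_cyclic k ?_ ?_ ?_⟩ <;>
      simp only [vert, pt_zero, pt_one, pt_two, ← h₀, ← h₁, ← h₂, ← hs, sg_mul_sg_mul]
  · rintro ⟨⟨k, s⟩, rfl⟩
    refine ⟨k, ?_⟩
    simp only [vert, pt_zero, pt_one, pt_two, abs_mul, abs_sg]
    norm_num

lemma vert_injective : Function.Injective vert := by
  rintro ⟨k, s⟩ ⟨l, t⟩ h
  have habs : ∀ k (s : Fin 3 → Bool), |vert (k, s) k| = 10 ∧ |vert (k, s) (k + 1)| = 2 ∧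
      |vert (k, s) (k + 2)| = 4 := fun k s => by
    simp only [vert, pt_zero, pt_one, pt_two, abs_mul, abs_sg]
    norm_num
  have hk := habs k s
  have hl := habs l t
  rw [h] at hk
  obtain rfl : l = k := by
    rcases eq_cyclic k l with rfl | rfl | rfl
    · rfl
    · linarith
    · linarith
  have hpos : ∀ s : Fin 3 → Bool, ∀ i, 0 < sg (s i) * vert (l, s) i := fun s =>
    forall_cyclic l (by simp [vert, sg_mul_sg_mul]) (by simp [vert, sg_mul_sg_mul])
      (by simp [vert, sg_mul_sg_mul])
  obtain rfl : s = t := funext fun i => sg_unique (hpos s i) (by rw [h]; exact hpos t i)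
  rfl

lemma not_mem_rect_rect {p k l a b} (hkl : k ≠ l) (h : p ∈ rect k a) (h' : p ∈ rect l b) :
    False := by
  have h := rect_abs h
  have h' := rect_abs h'
  rcases eq_cyclic k l with rfl | rfl | rfl
  · exact hkl rfl
  · simp only [add_one_add_two] at h'
    linarith
  · linarith

lemma isVert_of_rect_tri {p k a s} (h : p ∈ rect k a) (h' : p ∈ tri s) : IsVert p := by
  obtain ⟨h₀, h₁, h₂⟩ := rect_abs h
  obtain ⟨h', -⟩ := tri_abs h'
  rw [sum_cyclic _ k] at h'
  refine ⟨k + 1, ?_⟩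
  rw [add_one_add_one, add_one_add_two]
  exact ⟨by linarith, by linarith, h₀⟩

lemma isVert_of_trap_trap {p k l a b a' b'} (hkl : k ≠ l) (h : p ∈ trap k a b)
    (h' : p ∈ trap l a' b') : IsVert p := by
  have hstep : ∀ {k a b a' b'}, p ∈ trap k a b → p ∈ trap (k + 1) a' b' → IsVert p := by
    intro k a b a' b' h h'
    obtain ⟨h₀, h₁, h₂, -⟩ := trap_abs h
    obtain ⟨h₀', h₁', h₂', -⟩ := trap_abs h'
    rw [add_one_add_two] at h₀'
    refine ⟨k + 1, ?_⟩
    rw [add_one_add_one, add_one_add_two]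
    exact ⟨by linarith, by linarith, by linarith⟩
  rcases eq_cyclic k l with rfl | rfl | rfl
  · exact absurd rfl hkl
  · exact hstep h h'
  · exact hstep h' (by simpa only [add_two_add_one] using h)

lemma isVert_of_mem_three {p} {i j l : Idx} (hij : i ≠ j) (hil : i ≠ l) (hjl : j ≠ l)
    (hi : p ∈ face i) (hj : p ∈ face j) (hl : p ∈ face l) : IsVert p := by
  have hrr : ∀ {k a k' a'}, (.inl (k, a) : Idx) ≠ .inl (k', a') → p ∈ rect k a →
      p ∈ rect k' a' → False := by
    intro k a k' a' hne h h'
    by_cases hk : k = k'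
    · subst hk
      exact hne (by rw [rect_inj h h'])
    · exact not_mem_rect_rect hk h h'
  have htt : ∀ {k a b k' a' b'}, (.inr (.inl (k, a, b)) : Idx) ≠ .inr (.inl (k', a', b')) →
      p ∈ trap k a b → p ∈ trap k' a' b' → IsVert p := by
    intro k a b k' a' b' hne h h'
    by_cases hk : k = k'
    · subst hk
      exact (hne (by rw [(trap_inj h h').1, (trap_inj h h').2])).elim
    · exact isVert_of_trap_trap hk h h'
  have hss : ∀ {s t}, (.inr (.inr s) : Idx) ≠ .inr (.inr t) → p ∈ tri s → p ∈ tri t → False :=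
    fun hne h h' => hne (by rw [tri_inj h h'])
  rcases i with ⟨k, a⟩ | ⟨k, a, b⟩ | s <;> rcases j with ⟨k', a'⟩ | ⟨k', a', b'⟩ | s' <;>
    rcases l with ⟨k'', a''⟩ | ⟨k'', a'', b''⟩ | s'' <;>
    first
    | exact (hrr hij hi hj).elim
    | exact (hrr hil hi hl).elim
    | exact (hrr hjl hj hl).elim
    | exact (hss hij hi hj).elim
    | exact (hss hil hi hl).elim
    | exact (hss hjl hj hl).elim
    | exact htt hij hi hj
    | exact htt hil hi hl
    | exact htt hjl hj hl
    | exact isVert_of_rect_tri hi hj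
    | exact isVert_of_rect_tri hi hl
    | exact isVert_of_rect_tri hj hl
    | exact isVert_of_rect_tri hj hi
    | exact isVert_of_rect_tri hl hi
    | exact isVert_of_rect_tri hl hj

lemma exists_three_of_isVert {p} (h : IsVert p) : ∃ i j l : Idx, i ≠ j ∧ i ≠ l ∧ j ≠ l ∧
    p ∈ face i ∧ p ∈ face j ∧ p ∈ face l := by
  obtain ⟨k, h₀, h₁, h₂⟩ := h
  choose s hs using fun k => exists_sg_mul_eq_abs (p k)
  refine ⟨.inl (k + 2, s (k + 2)), .inr (.inl (k, s k, s (k + 2))), .inr (.inr s),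
    by simp, by simp, by simp, ?_, ?_, ?_, ?_⟩
  · simp only [face, rect, Set.mem_ofPred_eq, hs, add_two_add_one, add_two_add_two, h₀, h₁, h₂]
    norm_num
  · simp only [face, trap, Set.mem_ofPred_eq, hs, h₀, h₁, h₂]
    norm_num
  · simp only [hs, sum_cyclic _ k, h₀, h₁, h₂]
    norm_num
  · simp only [hs]
    refine forall_cyclic k ?_ ?_ ?_ <;>
      simp only [add_one_add_two, add_two_add_two, h₀, h₁, h₂] <;> norm_num

lemma disjoint_intrinsicInterior {i j : Idx} (hij : i ≠ j) :
    intrinsicInterior ℝ (face i) ∩ intrinsicInterior ℝ (face j) = ∅ := by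
  have hrt : ∀ {p k a l b c}, p ∈ intrinsicInterior ℝ (rect k a) →
      p ∈ intrinsicInterior ℝ (trap l b c) → False := by
    intro p k a l b c h h'
    have h₀ := rect_abs (intrinsicInterior_subset h)
    have h := rect_strict h
    have h' := trap_strict h'
    rcases eq_cyclic k l with rfl | rfl | rfl
    · linarith
    · rw [add_one_add_two] at h'
      linarith
    · linarith
  have hrs : ∀ {p k a s}, p ∈ intrinsicInterior ℝ (rect k a) →
      p ∈ intrinsicInterior ℝ (tri s) → False := by
    intro p k a s h h'
    have h₀ := rect_abs (intrinsicInterior_subset h)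
    have h := rect_strict h
    have h' := (tri_strict h').1
    rw [sum_cyclic _ k] at h'
    linarith
  have hts : ∀ {p k a b s}, p ∈ intrinsicInterior ℝ (trap k a b) →
      p ∈ intrinsicInterior ℝ (tri s) → False := by
    intro p k a b s h h'
    linarith [(trap_strict h).1, (tri_strict h').2 k]
  have htt : ∀ {p k a b a' b'}, p ∈ intrinsicInterior ℝ (trap k a b) →
      p ∈ intrinsicInterior ℝ (trap (k + 1) a' b') → False := by
    intro p k a b a' b' h h'
    have h := trap_strict h
    have h' := trap_strict h'
    rw [add_one_add_two] at h'
    linarith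
  refine Set.eq_empty_of_forall_notMem fun p ⟨hi, hj⟩ => ?_
  rcases i with ⟨k, a⟩ | ⟨k, a, b⟩ | s <;> rcases j with ⟨l, c⟩ | ⟨l, c, d⟩ | t
  · have hi := intrinsicInterior_subset hi
    have hj := intrinsicInterior_subset hj
    by_cases hkl : k = l
    · subst hkl
      exact hij (by rw [rect_inj hi hj])
    · exact not_mem_rect_rect hkl hi hj
  · exact hrt hi hj
  · exact hrs hi hj
  · exact hrt hj hi
  · rcases eq_cyclic k l with rfl | rfl | rfl
    · have h := trap_inj (intrinsicInterior_subset hi) (intrinsicInterior_subset hj)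
      exact hij (by rw [h.1, h.2])
    · exact htt hi hj
    · exact htt hj (by simpa only [face, add_two_add_one] using hi)
  · exact hts hi hj
  · exact hrs hj hi
  · exact hts hj hi
  · exact hij (by rw [tri_inj (intrinsicInterior_subset hi) (intrinsicInterior_subset hj)])

lemma zero_mem_openSolid : (0 : EuclideanSpace ℝ (Fin 3)) ∈ openSolid := by
  simp [openSolid]

lemma not_segment_subset {p} (h : IsVert p) : ¬ segment ℝ 0 p ⊆ solid := by
  obtain ⟨k, h₀, h₁, h₂⟩ := h
  intro hs
  have : (1 / 2 : ℝ) • p ∈ segment ℝ 0 p :=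
    ⟨1 / 2, 1 / 2, by norm_num, by norm_num, by norm_num, by simp⟩
  have := ((mem_solid_iff k).1 (hs this)).2.1
  simp only [PiLp.smul_apply, smul_eq_mul, abs_mul, h₀, h₂] at this
  norm_num [abs_of_pos] at this

lemma eq_convexHull_image {ι : Type*} [Fintype ι] {E : Type*} [AddCommGroup E] [Module ℝ E]
    [DecidableEq E] {C : Set E} (hC : Convex ℝ C) (f : ι → E) (hf : ∀ i, f i ∈ C)
    (h : ∀ p ∈ C, ∃ w : ι → ℝ, (∀ i, 0 ≤ w i) ∧ ∑ i, w i = 1 ∧ ∑ i, w i • f i = p) :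
    ∃ S : Finset E, C = convexHull ℝ (S : Set E) := by
  refine ⟨Finset.univ.image f, Set.Subset.antisymm (fun p hp => ?_) (convexHull_min ?_ hC)⟩
  · obtain ⟨w, hw, hw', rfl⟩ := h p hp
    exact (convex_convexHull ℝ _).sum_mem (fun i _ => hw i) hw'
      fun i _ => subset_convexHull ℝ _ (by simp)
  · intro x hx
    simp only [Finset.coe_image, Finset.coe_univ, Set.image_univ] at hx
    obtain ⟨i, rfl⟩ := hx
    exact hf i

lemma convex_abs_le (k : Fin 3) (c : ℝ) :
    Convex ℝ {p : EuclideanSpace ℝ (Fin 3) | |p k| ≤ c} := by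
  simpa using (convexOn_abs_coord k).convex_le c

lemma convex_rect (k a) : Convex ℝ (rect k a) := by
  intro x hx y hy s t hs ht hst
  refine ⟨?_, convex_abs_le _ _ hx.2.1 hy.2.1 hs ht hst, convex_abs_le _ _ hx.2.2 hy.2.2 hs ht hst⟩
  simp only [PiLp.add_apply, PiLp.smul_apply, smul_eq_mul]
  linear_combination s * hx.1 + t * hy.1 + 4 * hst

lemma convex_trap (k a b) : Convex ℝ (trap k a b) := by
  intro x hx y hy s t hs ht hst
  have hconv := (((convexOn_abs_coord (k + 1)).add (convexOn_coord k (sg a))).add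
    (convexOn_coord (k + 2) (sg b))).convex_le 16
  refine ⟨?_, ?_, ?_, (hconv ⟨Set.mem_univ _, hx.2.2.2⟩ ⟨Set.mem_univ _, hy.2.2.2⟩ hs ht hst).2⟩
  · simp only [PiLp.add_apply, PiLp.smul_apply, smul_eq_mul]
    linear_combination s * hx.1 + t * hy.1 + 2 * hst
  · simp only [PiLp.add_apply, PiLp.smul_apply, smul_eq_mul]
    linear_combination s * hx.2.1 + t * hy.2.1 - 4 * hst
  · simp only [PiLp.add_apply, PiLp.smul_apply, smul_eq_mul]
    linear_combination s * hx.2.2.1 + t * hy.2.2.1 + 10 * hst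

lemma convex_tri (s) : Convex ℝ (tri s) := by
  intro x hx y hy α β hα hβ hst
  refine ⟨?_, fun k => ?_⟩
  · have hx := hx.1
    have hy := hy.1
    simp only [PiLp.add_apply, PiLp.smul_apply, smul_eq_mul, sum_cyclic _ 0] at *
    linear_combination α * hx + β * hy + 16 * hst
  · simp only [PiLp.add_apply, PiLp.smul_apply, smul_eq_mul]
    linear_combination α * hx.2 k + β * hy.2 k - 2 * hst

/-- The corners of a rectangle. -/
noncomputable def rectCorner (k : Fin 3) (a : Bool) (i : Bool × Bool) :
    EuclideanSpace ℝ (Fin 3) :=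
  pt k (sg a * 4) (sg i.1 * 10) (sg i.2 * 2)

/-- The corners of a trapezoid. -/
noncomputable def trapCorner (k : Fin 3) (a b : Bool) (i : Bool × Bool) :
    EuclideanSpace ℝ (Fin 3) :=
  if i.1 then pt k (sg a * 10) (sg i.2 * 2) (sg b * 4)
  else pt k (sg a * 4) (sg i.2 * 10) (sg b * 2)

lemma rectCorner_mem (k a i) : rectCorner k a i ∈ rect k a := by
  simp only [rectCorner, rect, Set.mem_ofPred_eq, pt_zero, pt_one, pt_two, sg_mul_sg_mul,
    abs_mul, abs_sg]
  norm_num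

lemma trapCorner_mem (k a b i) : trapCorner k a b i ∈ trap k a b := by
  rw [trapCorner]
  split_ifs <;>
    simp only [trap, Set.mem_ofPred_eq, pt_zero, pt_one, pt_two, sg_mul_sg_mul, abs_mul, abs_sg] <;>
    norm_num

lemma sg_mul_vert (k : Fin 3) (s : Fin 3 → Bool) : sg (s k) * vert (k, s) k = 10 ∧
    sg (s (k + 1)) * vert (k, s) (k + 1) = 2 ∧ sg (s (k + 2)) * vert (k, s) (k + 2) = 4 := by
  simp only [vert, pt_zero, pt_one, pt_two, sg_mul_sg_mul, and_self]

lemma vert_mem_tri (k s) : vert (k, s) ∈ tri s := by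
  obtain ⟨h₀, h₁, h₂⟩ := sg_mul_vert k s
  refine ⟨?_, forall_cyclic k ?_ ?_ ?_⟩ <;>
    simp only [sum_cyclic _ k, add_one_add_two, add_two_add_two, h₀, h₁, h₂] <;> norm_num

lemma exists_convexHull_face (i : Idx) :
    ∃ S : Finset (EuclideanSpace ℝ (Fin 3)), face i = convexHull ℝ (S : Set _) := by
  classical
  rcases i with ⟨k, a⟩ | ⟨k, a, b⟩ | s
  · refine eq_convexHull_image (convex_rect k a) (rectCorner k a) (rectCorner_mem k a) ?_
    rintro p ⟨h₀, h₁, h₂⟩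
    rw [abs_le] at h₁ h₂
    have hp : p k = sg a * 4 := by rw [← h₀, sg_mul_sg_mul]
    refine ⟨fun i => (1 + sg i.1 * p (k + 1) / 10) / 2 * ((1 + sg i.2 * p (k + 2) / 2) / 2),
      ?_, ?_, ?_⟩
    · rintro ⟨i, j⟩
      refine mul_nonneg ?_ ?_
      · cases i <;> simp only [sg] <;> norm_num <;> linarith
      · cases j <;> simp only [sg] <;> norm_num <;> linarith
    · simp only [Fintype.sum_prod_type, Fintype.sum_bool, sg]
      norm_num
      ring
    · apply ext_cyclic k <;>
      simp only [Fintype.sum_prod_type, Fintype.sum_bool, rectCorner, PiLp.add_apply,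
        PiLp.smul_apply, pt_zero, pt_one, pt_two, hp, smul_eq_mul, sg_true, sg_false] <;>
      ring
  · refine eq_convexHull_image (convex_trap k a b) (trapCorner k a b) (trapCorner_mem k a b) ?_
    rintro p ⟨h₀, h₁, h₂, h₃⟩
    obtain ⟨t, ht⟩ : ∃ t, t = (sg a * p k - 4) / 6 := ⟨_, rfl⟩
    have hp : p k = sg a * (4 + 6 * t) := by
      rw [← sg_mul_sg_mul a (p k)]
      congr 1
      linarith
    have hp' : p (k + 2) = sg b * (2 + 2 * t) := by
      rw [← sg_mul_sg_mul b (p (k + 2))]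
      congr 1
      linarith
    have ht0 : 0 ≤ t := by linarith
    have ht1 : t ≤ 1 := by linarith
    have hd : 0 < 10 - 8 * t := by linarith
    obtain ⟨u, hu⟩ : ∃ u, u = p (k + 1) / (10 - 8 * t) := ⟨_, rfl⟩
    have hp'' : p (k + 1) = u * (10 - 8 * t) := by rw [hu]; field_simp
    have hu1 : |u| ≤ 1 := by
      rw [hu, abs_div, abs_of_pos hd, div_le_one hd]
      linarith
    rw [abs_le] at hu1
    refine ⟨fun i => (if i.1 then t else 1 - t) * ((1 + sg i.2 * u) / 2), ?_, ?_, ?_⟩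
    · rintro ⟨i, j⟩
      refine mul_nonneg ?_ ?_
      · cases i <;> simp <;> linarith
      · cases j <;> simp only [sg] <;> norm_num <;> linarith
    · simp only [Fintype.sum_prod_type, Fintype.sum_bool, sg]
      norm_num
      ring
    · apply ext_cyclic k <;>
      simp only [Fintype.sum_prod_type, Fintype.sum_bool, trapCorner, PiLp.add_apply,
        PiLp.smul_apply, pt_zero, pt_one, pt_two, hp, hp', hp'', smul_eq_mul, if_true,
        Bool.false_eq_true, if_false, sg_true, sg_false] <;>
      ring
  · refine eq_convexHull_image (convex_tri s) (fun k => vert (k, s)) (vert_mem_tri · s) ?_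
    rintro p ⟨h₀, h₁⟩
    refine ⟨fun k => (3 * (sg (s k) * p k) - sg (s (k + 1)) * p (k + 1) - 2) / 26, ?_, ?_, ?_⟩
    · intro k
      have := h₁ (k + 1)
      rw [add_one_add_two] at this
      linarith
    · simp only [sum_cyclic _ 0, add_one_add_one, add_two_add_one] at h₀ ⊢
      linarith
    · refine PiLp.ext fun k => ?_
      refine mul_left_cancel₀ (sg_ne_zero (s k)) ?_
      have e₀ := (sg_mul_vert k s).1
      have e₁ := (sg_mul_vert (k + 1) s).2.2
      have e₂ := (sg_mul_vert (k + 2) s).2.1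
      rw [add_one_add_two] at e₁
      rw [add_two_add_one] at e₂
      rw [sum_cyclic _ k] at h₀
      simp only [WithLp.ofLp_sum, Finset.sum_apply, PiLp.smul_apply, smul_eq_mul,
        sum_cyclic _ k, add_one_add_one, add_two_add_one]
      linear_combination (3 * (sg (s k) * p k) - sg (s (k + 1)) * p (k + 1) - 2) / 26 * e₀ +
        (3 * (sg (s (k + 1)) * p (k + 1)) - sg (s (k + 2)) * p (k + 2) - 2) / 26 * e₁ +
        (3 * (sg (s (k + 2)) * p (k + 2)) - sg (s k) * p k - 2) / 26 * e₂ + 2 / 26 * h₀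

lemma finrank_direction_eq_two {F : Set (EuclideanSpace ℝ (Fin 3))}
    (c : Fin 3 → ℝ) (hc : c ≠ 0) (d : ℝ) (hF : ∀ p ∈ F, ∑ i, c i * p i = d)
    {x y z : EuclideanSpace ℝ (Fin 3)} (hx : x ∈ F) (hy : y ∈ F) (hz : z ∈ F)
    (hli : LinearIndependent ℝ ![y - x, z - x]) :
    Module.finrank ℝ (affineSpan ℝ F).direction = 2 := by
  rw [direction_affineSpan]
  apply le_antisymm
  · let ℓ : EuclideanSpace ℝ (Fin 3) →ₗ[ℝ] ℝ :=
      ∑ i, c i • (EuclideanSpace.proj i : EuclideanSpace ℝ (Fin 3) →L[ℝ] ℝ).toLinearMap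
    have hℓ : ∀ p, ℓ p = ∑ i, c i * p i := fun p => by simp [ℓ]
    have hle : vectorSpan ℝ F ≤ LinearMap.ker ℓ := by
      rw [vectorSpan, Submodule.span_le]
      rintro _ ⟨p, hp, q, hq, rfl⟩
      simp [LinearMap.mem_ker, hℓ, mul_sub, hF p hp, hF q hq]
    have hlt : LinearMap.ker ℓ < ⊤ := by
      refine lt_top_iff_ne_top.2 fun h => hc (funext fun i => ?_)
      have := LinearMap.congr_fun (LinearMap.ker_eq_top.1 h) (EuclideanSpace.single i 1)
      simpa [hℓ] using this
    have hker := Submodule.finrank_lt hlt.ne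
    rw [finrank_euclideanSpace_fin] at hker
    exact (Submodule.finrank_mono hle).trans (Nat.le_of_lt_succ hker)
  · have h := finrank_span_eq_card hli
    rw [Fintype.card_fin] at h
    refine h.ge.trans ?_
    refine Submodule.finrank_mono (Submodule.span_le.2 ?_)
    rintro _ ⟨i, rfl⟩
    fin_cases i
    · exact vsub_mem_vectorSpan ℝ hy hx
    · exact vsub_mem_vectorSpan ℝ hz hx

lemma finrank_direction_face (i : Idx) :
    Module.finrank ℝ (affineSpan ℝ (face i)).direction = 2 := by
  rcases i with ⟨k, a⟩ | ⟨k, a, b⟩ | s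
  · refine finrank_direction_eq_two (pt k (sg a) 0 0)
      (fun h => sg_ne_zero a (by simpa using congrFun h k)) 4 ?_
      (rectCorner_mem k a (true, true)) (rectCorner_mem k a (true, false))
      (rectCorner_mem k a (false, true)) ?_
    · intro p hp
      simpa [sum_cyclic _ k] using hp.1
    · rw [LinearIndependent.pair_iff]
      intro α β h
      have h₁ := congrArg (fun v : EuclideanSpace ℝ (Fin 3) => v (k + 1)) h
      have h₂ := congrArg (fun v : EuclideanSpace ℝ (Fin 3) => v (k + 2)) h
      simp only [rectCorner, sg_true, sg_false, PiLp.add_apply, PiLp.smul_apply, PiLp.sub_apply,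
        PiLp.zero_apply, smul_eq_mul, pt_one, pt_two] at h₁ h₂
      constructor <;> linarith
  · refine finrank_direction_eq_two (pt k (-sg a) 0 (3 * sg b))
      (fun h => sg_ne_zero a (by simpa using congrFun h k)) 2 ?_
      (trapCorner_mem k a b (true, true)) (trapCorner_mem k a b (true, false))
      (trapCorner_mem k a b (false, true)) ?_
    · intro p hp
      simp only [sum_cyclic _ k, pt_zero, pt_one, pt_two]
      linarith [hp.1]
    · rw [LinearIndependent.pair_iff]
      intro α β h
      have h₀ := congrArg (fun v : EuclideanSpace ℝ (Fin 3) => sg a * v k) h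
      have h₁ := congrArg (fun v : EuclideanSpace ℝ (Fin 3) => v (k + 1)) h
      simp only [trapCorner, if_true, Bool.false_eq_true, if_false, sg_true, sg_false,
        PiLp.add_apply, PiLp.smul_apply, PiLp.sub_apply, PiLp.zero_apply, smul_eq_mul, pt_zero,
        pt_one, mul_add, mul_sub, mul_left_comm (sg a), sg_mul_sg_mul, mul_zero] at h₀ h₁
      constructor <;> linarith
  · refine finrank_direction_eq_two (fun i => sg (s i)) (fun h => sg_ne_zero (s 0) (congrFun h 0)) 16
      (fun p hp => hp.1) (vert_mem_tri 0 s) (vert_mem_tri (0 + 1) s) (vert_mem_tri (0 + 2) s) ?_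
    rw [LinearIndependent.pair_iff]
    intro α β h
    have h₀ := congrArg (fun v : EuclideanSpace ℝ (Fin 3) => sg (s 0) * v 0) h
    have h₁ := congrArg (fun v : EuclideanSpace ℝ (Fin 3) => sg (s (0 + 1)) * v (0 + 1)) h
    obtain ⟨e₀, e₁, -⟩ := sg_mul_vert 0 s
    obtain ⟨e₂, -, e₃⟩ := sg_mul_vert (0 + 1) s
    obtain ⟨-, e₄, e₅⟩ := sg_mul_vert (0 + 2) s
    rw [add_one_add_two] at e₃
    rw [add_two_add_one] at e₄
    rw [add_two_add_two] at e₅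
    simp only [PiLp.add_apply, PiLp.smul_apply, PiLp.sub_apply, PiLp.zero_apply, smul_eq_mul,
      mul_zero] at h₀ h₁
    have h₀' : α * (4 - 10) + β * (2 - 10) = 0 := by
      linear_combination h₀ - α * (e₃ - e₀) - β * (e₄ - e₀)
    have h₁' : α * (10 - 2) + β * (4 - 2) = 0 := by
      linear_combination h₁ - α * (e₂ - e₁) - β * (e₅ - e₁)
    constructor <;> linarith

lemma card_idx : Fintype.card Idx = 26 := by
  simp [Idx]

lemma polyhedronVertices_face (e : Fin 26 ≃ Idx) :
    polyhedronVertices 26 (fun i => face (e i)) = Set.range vert := by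
  ext p
  rw [← isVert_iff]
  constructor
  · rintro ⟨i, j, l, hij, hil, hjl, hi, hj, hl⟩
    exact isVert_of_mem_three (e.injective.ne hij) (e.injective.ne hil) (e.injective.ne hjl)
      hi hj hl
  · intro h
    obtain ⟨i, j, l, hij, hil, hjl, hi, hj, hl⟩ := exists_three_of_isVert h
    exact ⟨e.symm i, e.symm j, e.symm l, e.symm.injective.ne hij, e.symm.injective.ne hil,
      e.symm.injective.ne hjl, by simpa using hi, by simpa using hj, by simpa using hl⟩

end Uberoctoplex

/-- There is a polyhedron with exactly 24 vertices and exactly 26 faces (the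
Überoctoplex) whose interior is not guarded by placing a guard at every vertex:
some interior point sees no vertex. -/
theorem exists_uberoctoplex :
    ∃ (F : Fin 26 → Set (EuclideanSpace ℝ (Fin 3))) (P : Set (EuclideanSpace ℝ (Fin 3))),
      IsPolyhedron 26 F P ∧
      (polyhedronVertices 26 F).ncard = 24 ∧
      ∃ q ∈ interior P, ∀ x ∈ polyhedronVertices 26 F, ¬ segment ℝ q x ⊆ P := by
  have e : Fin 26 ≃ Uberoctoplex.Idx := (Fintype.equivFinOfCardEq Uberoctoplex.card_idx).symm
  refine ⟨fun i => Uberoctoplex.face (e i), Uberoctoplex.solid,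
    ⟨Uberoctoplex.isCompact_solid, Uberoctoplex.solid_eq_closure_interior,
      fun i => Uberoctoplex.exists_convexHull_face (e i),
      fun i => Uberoctoplex.finrank_direction_face (e i),
      fun i j hij => Uberoctoplex.disjoint_intrinsicInterior (e.injective.ne hij), ?_⟩, ?_,
    0, Uberoctoplex.openSolid_subset_interior Uberoctoplex.zero_mem_openSolid, fun x hx => ?_⟩
  · rw [Uberoctoplex.frontier_solid, ← e.surjective.iUnion_comp]
  · rw [Uberoctoplex.polyhedronVertices_face, Set.ncard_def, ← Set.image_univ,
      Uberoctoplex.vert_injective.encard_image, ← Set.ncard_def, Set.ncard_univ]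
    simp
  · rw [Uberoctoplex.polyhedronVertices_face, ← Uberoctoplex.isVert_iff] at hx
    exact Uberoctoplex.not_segment_subset hx
end
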